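/- Let k ≥ 5 and n ≥ 2k be integers, let T be a plane triangulation on n vertices, and let G be a spanning subgraph of T that contains a matching of size k − 1 and has at least 2n + 6k − 16 edges. Then G contains a matching of size k. -/

import Mathlib

/-- A topological planar embedding of a simple graph `G`: an injective placement `f` of the
vertices in the plane together with, for each edge, an arc `γ e : ℝ → ℝ × ℝ` that is
continuous and injective on `[0,1]`, joins the images of the two endpoints of the edge,
whose interior avoids all vertex images, and such that interiors of distinct arcs are
pairwise disjoint. -/
def SimpleGraph.IsPlanarEmbedding {V : Type*} (G : SimpleGraph V) (f : V → ℝ × ℝ)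
    (γ : G.edgeSet → ℝ → ℝ × ℝ) : Prop :=
  Function.Injective f ∧
  (∀ e : G.edgeSet, ContinuousOn (γ e) (Set.Icc 0 1)) ∧
  (∀ e : G.edgeSet, Set.InjOn (γ e) (Set.Icc 0 1)) ∧
  (∀ e : G.edgeSet, ∃ u v : V, (e : Sym2 V) = s(u, v) ∧ γ e 0 = f u ∧ γ e 1 = f v) ∧
  (∀ e : G.edgeSet, ∀ t ∈ Set.Ioo (0 : ℝ) 1, ∀ v : V, γ e t ≠ f v) ∧
  (∀ e₁ e₂ : G.edgeSet, e₁ ≠ e₂ → ∀ t₁ ∈ Set.Ioo (0 : ℝ) 1, ∀ t₂ ∈ Set.Ioo (0 : ℝ) 1,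
      γ e₁ t₁ ≠ γ e₂ t₂)

/-- A simple graph is planar if it admits a topological planar embedding. -/
def SimpleGraph.IsPlanar {V : Type*} (G : SimpleGraph V) : Prop :=
  ∃ f γ, G.IsPlanarEmbedding f γ

/-- A plane triangulation on `n` vertices: a maximal planar simple graph on `n ≥ 3`
vertices, i.e. a planar graph with exactly `3n - 6` edges. -/
def IsPlaneTriangulation {n : ℕ} (G : SimpleGraph (Fin n)) : Prop :=
  3 ≤ n ∧ G.IsPlanar ∧ G.edgeSet.ncard = 3 * n - 6

/-- `M` is a matching of size `k` in `G` (a copy of `kK₂`): a set of `k` pairwise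
vertex-disjoint edges of `G`. -/
def IsMatchingOfSize {V : Type*} (G : SimpleGraph V) (M : Finset (Sym2 V)) (k : ℕ) : Prop :=
  M.card = k ∧ (↑M : Set (Sym2 V)) ⊆ G.edgeSet ∧
    ∀ e ∈ M, ∀ e' ∈ M, e ≠ e' → ∀ v : V, v ∈ e → v ∉ e'

/-- Under the edge-coloring `c`, the graph `G` contains a rainbow matching of size `k`. -/
def HasRainbowMatching {V α : Type*} (G : SimpleGraph V) (c : Sym2 V → α) (k : ℕ) : Prop :=
  ∃ M : Finset (Sym2 V), IsMatchingOfSize G M k ∧ Set.InjOn c (↑M : Set (Sym2 V))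

/-- `r` colors suffice for rainbow `kK₂` in every plane triangulation on `n` vertices:
every edge-coloring of such a triangulation using at least `r` distinct colors contains
a rainbow matching of size `k`. -/
def RainbowThreshold (n k r : ℕ) : Prop :=
  ∀ G : SimpleGraph (Fin n), IsPlaneTriangulation G →
    ∀ c : Sym2 (Fin n) → ℕ, r ≤ (c '' G.edgeSet).ncard → HasRainbowMatching G c k

section PlanarityAndMatching

open Set Filter Topology

/-! ### Signs of square-root transport along paths -/

/-- Continuous square roots along a path. -/
theorem exists_sqrt_lift (h : ℝ → ℂ) (hc : Continuous h) (hne : ∀ t ∈ Icc (0:ℝ) 3, h t ≠ 0) :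
    ∃ s : ℝ → ℂ, Continuous s ∧ ∀ t ∈ Icc (0:ℝ) 3, s t ^ 2 = h t := by
  have hm : ∀ t : unitInterval, 3 * (t:ℝ) ∈ Icc (0:ℝ) 3 := fun t =>
    ⟨by have := t.2.1; linarith, by have := t.2.2; linarith⟩
  let γ : C(unitInterval, {z : ℂ // z ≠ 0}) :=
    ⟨fun t => ⟨h (3 * (t:ℝ)), hne _ (hm t)⟩, by fun_prop⟩
  obtain ⟨Γ, hΓ, -⟩ := Complex.isCoveringMap_exp.exists_path_lifts γ (Complex.log (h (3 * (0:ℝ))))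
    (by
      apply Subtype.ext
      simp only [γ, ContinuousMap.coe_mk]
      rw [Complex.exp_log (by simpa using hne 0 (by simp))]
      simp)
  refine ⟨fun t => Complex.exp (Γ (projIcc (0:ℝ) 1 zero_le_one (t / 3)) / 2), ?_, ?_⟩
  · have : Continuous fun t : ℝ => Γ (projIcc (0:ℝ) 1 zero_le_one (t / 3)) :=
      Γ.continuous.comp (continuous_projIcc.comp (by fun_prop))
    fun_prop
  · intro t ht
    have ht' : t / 3 ∈ Icc (0:ℝ) 1 := ⟨by linarith [ht.1], by linarith [ht.2]⟩
    have h1 := congrArg Subtype.val (congrFun hΓ (projIcc (0:ℝ) 1 zero_le_one (t / 3)))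
    simp only [Function.comp, γ, ContinuousMap.coe_mk] at h1
    rw [← Complex.exp_nat_mul]
    rw [projIcc_of_mem zero_le_one ht'] at h1 ⊢
    have : 3 * (t / 3) = t := by ring
    simp only [this] at h1
    rw [← h1]
    congr 1
    push_cast
    ring

noncomputable section

/-- Parity of the sign of a real number. -/
def sg (x : ℝ) : ZMod 2 := if x < 0 then 1 else 0

theorem sg_neg {x : ℝ} (hx : x ≠ 0) : sg (-x) = sg x + 1 := by
  unfold sg
  rcases lt_or_gt_of_ne hx with h | h
  · have : ¬ (-x < 0) := by linarith
    simp only [h, this, if_true, if_false]; decide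
  · have : ¬ (x < 0) := by linarith
    have h' : -x < 0 := by linarith
    simp only [h', this, if_true, if_false]; decide

theorem sg_pos {x : ℝ} (hx : 0 < x) : sg x = 0 := by
  unfold sg; rw [if_neg (by linarith)]

theorem sg_of_neg {x : ℝ} (hx : x < 0) : sg x = 1 := by
  unfold sg; rw [if_pos hx]

/-- A continuous nowhere vanishing function keeps its sign. -/
theorem sg_const {φ : ℝ → ℝ} {a b : ℝ} (hab : a ≤ b) (hc : ContinuousOn φ (Icc a b))
    (hne : ∀ t ∈ Icc a b, φ t ≠ 0) : sg (φ a) = sg (φ b) := by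
  have ha := hne a ⟨le_rfl, hab⟩
  have hb := hne b ⟨hab, le_rfl⟩
  rcases lt_or_gt_of_ne ha with h1 | h1 <;> rcases lt_or_gt_of_ne hb with h2 | h2
  · rw [sg_of_neg h1, sg_of_neg h2]
  · obtain ⟨t, ht, h0⟩ := intermediate_value_Icc hab hc ⟨h1.le, h2.le⟩
    exact absurd h0 (hne t ht)
  · obtain ⟨t, ht, h0⟩ := intermediate_value_Icc' hab hc ⟨h2.le, h1.le⟩
    exact absurd h0 (hne t ht)
  · rw [sg_pos h1, sg_pos h2]

/-- A chosen square root. -/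
def rt (w : ℂ) : ℂ := w ^ ((2:ℕ)⁻¹ : ℂ)

theorem rt_sq (w : ℂ) : rt w ^ 2 = w := Complex.cpow_nat_inv_pow w two_ne_zero

open Classical in
/-- A chosen continuous square root of `g - p` on `[0,3]`. -/
def sl (g : ℝ → ℂ) (p : ℂ) : ℝ → ℂ :=
  if H : ∃ s : ℝ → ℂ, Continuous s ∧ ∀ t ∈ Icc (0:ℝ) 3, s t ^ 2 = g t - p then H.choose else 0

theorem sl_spec {g : ℝ → ℂ} (hg : Continuous g) {p : ℂ} (hp : ∀ t ∈ Icc (0:ℝ) 3, g t ≠ p) :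
    Continuous (sl g p) ∧ ∀ t ∈ Icc (0:ℝ) 3, sl g p t ^ 2 = g t - p := by
  have H : ∃ s : ℝ → ℂ, Continuous s ∧ ∀ t ∈ Icc (0:ℝ) 3, s t ^ 2 = g t - p :=
    exists_sqrt_lift _ (by fun_prop) fun t ht => sub_ne_zero.2 (hp t ht)
  unfold sl
  rw [dif_pos H]
  exact H.choose_spec

/-- The sign of the path `g` seen from `p`. -/
def psg (g : ℝ → ℂ) (p : ℂ) : ZMod 2 :=
  sg ((sl g p 3 * rt (g 0 - p)) / (sl g p 0 * rt (g 3 - p))).re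

/-- The correction at the vertex `x` for moving from `p` to `q`. -/
def csg (x p q : ℂ) : ZMod 2 := sg (rt (x - q) / rt (x - p)).re

theorem re_ne_zero_of_sq {y : ℂ} (h : y ^ 2 ∈ Complex.slitPlane) : y.re ≠ 0 := by
  intro h0
  rw [Complex.mem_slitPlane_iff] at h
  simp only [pow_two, Complex.mul_re, Complex.mul_im, h0] at h
  rcases h with h | h
  · nlinarith [sq_nonneg y.im]
  · simp at h

/-- The square root of the ratio. -/
def kap (g : ℝ → ℂ) (p q : ℂ) (t : ℝ) : ℂ := sl g q t / sl g p t

theorem sl_ne {g : ℝ → ℂ} (hg : Continuous g) {p : ℂ} (hp : ∀ t ∈ Icc (0:ℝ) 3, g t ≠ p)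
    {t : ℝ} (ht : t ∈ Icc (0:ℝ) 3) : sl g p t ≠ 0 := by
  intro h
  have := (sl_spec hg hp).2 t ht
  rw [h] at this
  exact sub_ne_zero.2 (hp t ht) (by simpa using this.symm)

theorem kap_sq {g : ℝ → ℂ} (hg : Continuous g) {p q : ℂ} (hp : ∀ t ∈ Icc (0:ℝ) 3, g t ≠ p)
    (hq : ∀ t ∈ Icc (0:ℝ) 3, g t ≠ q) {t : ℝ} (ht : t ∈ Icc (0:ℝ) 3) :
    kap g p q t ^ 2 = (g t - q) / (g t - p) := by
  unfold kap
  rw [div_pow, (sl_spec hg hp).2 t ht, (sl_spec hg hq).2 t ht]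

theorem kap_cont {g : ℝ → ℂ} (hg : Continuous g) {p q : ℂ} (hp : ∀ t ∈ Icc (0:ℝ) 3, g t ≠ p)
    (hq : ∀ t ∈ Icc (0:ℝ) 3, g t ≠ q) : ContinuousOn (kap g p q) (Icc 0 3) :=
  (sl_spec hg hq).1.continuousOn.div (sl_spec hg hp).1.continuousOn fun _ ht => sl_ne hg hp ht

theorem psg_compare {g : ℝ → ℂ} (hg : Continuous g) {p q : ℂ}
    (hp : ∀ t ∈ Icc (0:ℝ) 3, g t ≠ p) (hq : ∀ t ∈ Icc (0:ℝ) 3, g t ≠ q)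
    (h0 : (g 0 - q) / (g 0 - p) ∈ Complex.slitPlane)
    (h3 : (g 3 - q) / (g 3 - p) ∈ Complex.slitPlane) :
    psg g p + psg g q = csg (g 0) p q + csg (g 3) p q
      + (sg (kap g p q 0).re + sg (kap g p q 3).re) := by
  have m0 : (0:ℝ) ∈ Icc (0:ℝ) 3 := by norm_num
  have m3 : (3:ℝ) ∈ Icc (0:ℝ) 3 := by norm_num
  have rne : ∀ {x y : ℂ}, x ≠ y → rt (x - y) ≠ 0 := by
    intro x y hxy h
    have := rt_sq (x - y)
    rw [h] at this
    exact sub_ne_zero.2 hxy (by simpa using this.symm)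
  have p0 := sl_ne hg hp m0
  have p3 := sl_ne hg hp m3
  have q0 := sl_ne hg hq m0
  have q3 := sl_ne hg hq m3
  have rp0 := rne (hp 0 m0)
  have rp3 := rne (hp 3 m3)
  have rq0 := rne (hq 0 m0)
  have rq3 := rne (hq 3 m3)
  have e0 : sl g p 0 = rt (g 0 - p) ∨ sl g p 0 = - rt (g 0 - p) :=
    sq_eq_sq_iff_eq_or_eq_neg.1 (by rw [rt_sq, (sl_spec hg hp).2 0 m0])
  have e3 : sl g p 3 = rt (g 3 - p) ∨ sl g p 3 = - rt (g 3 - p) :=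
    sq_eq_sq_iff_eq_or_eq_neg.1 (by rw [rt_sq, (sl_spec hg hp).2 3 m3])
  have f0 : sl g q 0 = rt (g 0 - q) ∨ sl g q 0 = - rt (g 0 - q) :=
    sq_eq_sq_iff_eq_or_eq_neg.1 (by rw [rt_sq, (sl_spec hg hq).2 0 m0])
  have f3 : sl g q 3 = rt (g 3 - q) ∨ sl g q 3 = - rt (g 3 - q) :=
    sq_eq_sq_iff_eq_or_eq_neg.1 (by rw [rt_sq, (sl_spec hg hq).2 3 m3])
  have n0 : (rt (g 0 - q) / rt (g 0 - p)).re ≠ 0 := by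
    apply re_ne_zero_of_sq; rw [div_pow, rt_sq, rt_sq]; exact h0
  have n3 : (rt (g 3 - q) / rt (g 3 - p)).re ≠ 0 := by
    apply re_ne_zero_of_sq; rw [div_pow, rt_sq, rt_sq]; exact h3
  have s0 := sg_neg n0
  have s3 := sg_neg n3
  have hone : ∀ a b : ℂ, a ≠ 0 → b ≠ 0 → sg ((a * b) / (b * a)).re = 0 := by
    intro a b ha hb
    rw [mul_comm b a, div_self (mul_ne_zero ha hb)]
    exact sg_pos (by simp)
  have hmone : ∀ a b : ℂ, a ≠ 0 → b ≠ 0 → sg (-((a * b) / (b * a)).re) = 1 := by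
    intro a b ha hb
    rw [mul_comm b a, div_self (mul_ne_zero ha hb)]
    exact sg_of_neg (by simp)
  unfold psg csg kap
  have key : ∀ x y : ZMod 2, x + y + (x + y) = 0 ∧ x + y + (x + 1 + y) = 1 ∧
     x + y + (x + (y + 1)) = 1 ∧ x + y + (x + 1 + (y + 1)) = 0 := by decide
  obtain ⟨k1, k2, k3, k4⟩ := key (sg (rt (g 0 - q) / rt (g 0 - p)).re) (sg (rt (g 3 - q) / rt (g 3 - p)).re)
  have two : (1 : ZMod 2) + 1 = 0 := by decide
  rcases e0 with e0 | e0 <;> rcases e3 with e3 | e3 <;> rcases f0 with f0 | f0 <;>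
    rcases f3 with f3 | f3 <;> rw [e0, e3, f0, f3] <;>
    simp only [neg_mul, neg_div, div_neg, neg_neg, Complex.neg_re, s0, s3, hone _ _ rp3 rp0,
      hone _ _ rq3 rq0, hmone _ _ rp3 rp0, hmone _ _ rq3 rq0, k1, k2, k3, k4, two, add_zero, zero_add]

/-- If `q` is closer to `p` than `x` is, the ratio is in the slit plane. -/
theorem ratio_slit {x p q : ℂ} (h : ‖q - p‖ < ‖x - p‖) : (x - q) / (x - p) ∈ Complex.slitPlane := by
  have hne : x - p ≠ 0 := by
    intro h0; rw [h0, norm_zero] at h; exact absurd h (not_lt.2 (norm_nonneg _))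
  have : (x - q) / (x - p) = 1 + (-((q - p) / (x - p))) := by field_simp; ring
  rw [this]
  apply Complex.mem_slitPlane_of_norm_lt_one
  rw [norm_neg, norm_div, div_lt_one (norm_pos_iff.2 hne)]
  exact h

theorem psg_near {g : ℝ → ℂ} (hg : Continuous g) {p q : ℂ}
    (h : ∀ t ∈ Icc (0:ℝ) 3, ‖q - p‖ < ‖g t - p‖) :
    psg g p + psg g q = csg (g 0) p q + csg (g 3) p q := by
  have hp : ∀ t ∈ Icc (0:ℝ) 3, g t ≠ p := by
    intro t ht h0
    have := h t ht
    rw [h0, sub_self, norm_zero] at this; exact absurd this (not_lt.2 (norm_nonneg _))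
  have hq : ∀ t ∈ Icc (0:ℝ) 3, g t ≠ q := by
    intro t ht h0
    have := h t ht
    rw [h0] at this; exact lt_irrefl _ this
  rw [psg_compare hg hp hq (ratio_slit (h 0 (by norm_num))) (ratio_slit (h 3 (by norm_num)))]
  have := sg_const (φ := fun t => (kap g p q t).re) (a := 0) (b := 3) (by norm_num)
    (Complex.continuous_re.comp_continuousOn (kap_cont hg hp hq)) (by
      intro t ht
      apply re_ne_zero_of_sq
      rw [kap_sq hg hp hq ht]
      exact ratio_slit (h t ht))
  rw [this]
  have : ∀ x : ZMod 2, x + x = 0 := by decide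
  rw [this, add_zero]

/-- Crossing a straight piece of the path over `[c,d]`. -/
theorem psg_jump {g : ℝ → ℂ} (hg : Continuous g) {p q : ℂ} {c d : ℝ} (hc : 0 ≤ c) (hcd : c ≤ d)
    (hd : d ≤ 3)
    (hp : ∀ t ∈ Icc (0:ℝ) 3, g t ≠ p) (hq : ∀ t ∈ Icc (0:ℝ) 3, g t ≠ q)
    (h1 : ∀ t ∈ Icc 0 c, ‖q - p‖ < ‖g t - p‖) (h2 : ∀ t ∈ Icc d 3, ‖q - p‖ < ‖g t - p‖)
    (k : ℂ) (w : ℝ → ℂ) (hw : Continuous w)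
    (hwp : ∀ t ∈ Icc c d, g t - p = k * w t)
    (hwq : ∀ t ∈ Icc c d, g t - q = k * (starRingEnd ℂ) (w t))
    (hre : (w c).re * (w d).re < 0) :
    psg g p + psg g q = csg (g 0) p q + csg (g 3) p q + 1 := by
  rw [psg_compare hg hp hq (ratio_slit (h1 0 ⟨le_rfl, hc⟩)) (ratio_slit (h2 3 ⟨hd, le_rfl⟩))]
  congr 1
  have hk := kap_cont hg hp hq
  have a1 := sg_const (φ := fun t => (kap g p q t).re) (a := 0) (b := c) hc
    (Complex.continuous_re.comp_continuousOn (hk.mono (Icc_subset_Icc le_rfl (hcd.trans hd)))) (by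
      intro t ht
      apply re_ne_zero_of_sq
      rw [kap_sq hg hp hq ⟨ht.1, ht.2.trans (hcd.trans hd)⟩]
      exact ratio_slit (h1 t ht))
  have a2 := sg_const (φ := fun t => (kap g p q t).re) (a := d) (b := 3) hd
    (Complex.continuous_re.comp_continuousOn (hk.mono (Icc_subset_Icc (hc.trans hcd) le_rfl))) (by
      intro t ht
      apply re_ne_zero_of_sq
      rw [kap_sq hg hp hq ⟨(hc.trans hcd).trans ht.1, ht.2⟩]
      exact ratio_slit (h2 t ht))
  rw [a1, ← a2]
  have hsub : Icc c d ⊆ Icc (0:ℝ) 3 := Icc_subset_Icc hc hd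
  have hwne : ∀ t ∈ Icc c d, w t ≠ 0 := by
    intro t ht h0
    have := hwp t ht
    rw [h0, mul_zero] at this
    exact sub_ne_zero.2 (hp t (hsub ht)) this
  have hkne : k ≠ 0 := by
    intro h0
    have := hwp c ⟨le_rfl, hcd⟩
    rw [h0, zero_mul] at this
    exact sub_ne_zero.2 (hp c (hsub ⟨le_rfl, hcd⟩)) this
  let y : ℝ → ℂ := fun t => (starRingEnd ℂ) (w t) / (‖w t‖ : ℂ)
  have hyne : ∀ t ∈ Icc c d, y t ≠ 0 := by
    intro t ht
    exact div_ne_zero (by simpa using hwne t ht) (by simpa using hwne t ht)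
  have hyc : ContinuousOn y (Icc c d) := by
    apply ContinuousOn.div
    · exact (Complex.continuous_conj.comp hw).continuousOn
    · exact (Complex.continuous_ofReal.comp hw.norm).continuousOn
    · intro t ht; simpa using hwne t ht
  have hsq : EqOn (kap g p q ^ 2) (y ^ 2) (Icc c d) := by
    intro t ht
    simp only [Pi.pow_apply]
    rw [kap_sq hg hp hq (hsub ht), hwp t ht, hwq t ht, mul_div_mul_left _ _ hkne]
    simp only [y, div_pow]
    have h1 : ((‖w t‖ : ℂ)) ^ 2 = w t * (starRingEnd ℂ) (w t) := by
      rw [Complex.mul_conj, Complex.normSq_eq_norm_sq]; push_cast; rfl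
    have h3 : (starRingEnd ℂ) (w t) ≠ 0 := by simpa using hwne t ht
    rw [h1]
    have := hwne t ht
    field_simp
  have hyre : ∀ t, (y t).re = (w t).re / ‖w t‖ := by
    intro t
    simp only [y]
    rw [Complex.div_ofReal_re, Complex.conj_re]
  have hprod : (y c).re * (y d).re < 0 := by
    rw [hyre, hyre, div_mul_div_comm]
    apply div_neg_of_neg_of_pos hre
    have := norm_pos_iff.2 (hwne c ⟨le_rfl, hcd⟩)
    have := norm_pos_iff.2 (hwne d ⟨hcd, le_rfl⟩)
    positivity
  have hprod2 : (kap g p q c).re * (kap g p q d).re < 0 := by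
    rcases isPreconnected_Icc.eq_or_eq_neg_of_sq_eq (hk.mono hsub) hyc hsq
      (fun {x} hx => hyne x hx) with h | h
    · rw [h ⟨le_rfl, hcd⟩, h ⟨hcd, le_rfl⟩]; exact hprod
    · rw [h ⟨le_rfl, hcd⟩, h ⟨hcd, le_rfl⟩]; simpa using hprod
  rcases mul_neg_iff.1 hprod2 with ⟨u, v⟩ | ⟨u, v⟩
  · rw [sg_pos u, sg_of_neg v, zero_add]
  · rw [sg_of_neg u, sg_pos v, add_zero]

end


open Set Filter Topology
set_option linter.unusedSectionVars false

/-! ### Drawings which are straight near the vertices -/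

theorem const_on_Icc {X : Type*} {φ : ℝ → X} {a b : ℝ} (hab : a ≤ b)
    (h : ∀ t ∈ Icc a b, ∀ᶠ s in 𝓝 t, φ s = φ t) : φ a = φ b := by
  let _ : TopologicalSpace X := ⊥
  have : DiscreteTopology X := ⟨rfl⟩
  refine isPreconnected_Icc.constant (f := φ) (s := Icc a b) ?_ ⟨le_rfl, hab⟩ ⟨hab, le_rfl⟩
  intro t ht
  apply ContinuousAt.continuousWithinAt
  exact (continuousAt_const (y := φ t)).congr ((h t ht).mono fun _ hs => hs.symm)

theorem zmod2_self (x : ZMod 2) : x + x = 0 := by revert x; decide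

theorem telescope (W : ℝ → ZMod 2) (F : Finset ℝ) (α : ℝ) : ∀ β : ℝ, α ≤ β →
    (∀ θ ∈ F, α < θ ∧ θ < β) →
    (∀ t ∈ Icc α β, t ∉ F → ∀ᶠ s in 𝓝 t, W s = W t) →
    ∀ᶠ ε in 𝓝[>] (0:ℝ), ∑ θ ∈ F, (W (θ - ε) + W (θ + ε)) = W α + W β := by
  induction F using Finset.induction_on_max with
  | empty =>
    intro β hab _ h
    have := const_on_Icc hab (fun t ht => h t ht (by simp))
    simp [this, zmod2_self]
  | insert a s hs ih =>
    intro β hab hF h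
    have ha := hF a (Finset.mem_insert_self _ _)
    have hγ : ∀ᶠ γ in 𝓝[<] a, (∀ x ∈ s, x < γ) ∧ α < γ ∧ γ < a := by
      refine Filter.Eventually.and ?_ (Filter.Eventually.and ?_ self_mem_nhdsWithin)
      · rw [Filter.eventually_all_finset]
        intro x hx
        exact mem_nhdsWithin_of_mem_nhds (lt_mem_nhds (hs x hx))
      · exact mem_nhdsWithin_of_mem_nhds (lt_mem_nhds ha.1)
    obtain ⟨γ, g1, g2, g3⟩ := hγ.exists
    have ih' := ih γ g2.le (fun θ hθ => ⟨(hF θ (Finset.mem_insert_of_mem hθ)).1, g1 θ hθ⟩) (by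
      intro t ht hts
      refine h t ⟨ht.1, ht.2.trans (g3.le.trans ha.2.le)⟩ ?_
      rw [Finset.mem_insert]
      rintro (rfl | h')
      · exact absurd ht.2 (not_le.2 g3)
      · exact hts h')
    have e1 : ∀ᶠ ε in 𝓝[>] (0:ℝ), ε < a - γ :=
      mem_nhdsWithin_of_mem_nhds (gt_mem_nhds (by linarith))
    have e2 : ∀ᶠ ε in 𝓝[>] (0:ℝ), ε < β - a :=
      mem_nhdsWithin_of_mem_nhds (gt_mem_nhds (by linarith))
    filter_upwards [ih', e1, e2, self_mem_nhdsWithin] with ε i1 i2 i3 i4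
    have i4 : 0 < ε := i4
    rw [Finset.sum_insert (fun h' => lt_irrefl _ (hs a h')), i1]
    have c1 : W γ = W (a - ε) := by
      refine const_on_Icc (by linarith) fun t ht => h t ⟨by linarith [ht.1], by linarith [ht.2]⟩ ?_
      rw [Finset.mem_insert]
      rintro (rfl | h')
      · linarith [ht.2]
      · linarith [ht.1, g1 t h']
    have c2 : W (a + ε) = W β := by
      refine const_on_Icc (by linarith) fun t ht => h t ⟨by linarith [ht.1], by linarith [ht.2]⟩ ?_
      rw [Finset.mem_insert]
      rintro (rfl | h')
      · linarith [ht.1]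
      · linarith [ht.1, hs t h']
    rw [← c1, c2]
    linear_combination zmod2_self (W γ)

/-- A drawing of a multigraph with straight ends. -/
structure NiceDrawing (V E : Type*) where
  f : V → ℂ
  A : E → V
  B : E → V
  hAB : ∀ e, A e ≠ B e
  ρ : ℝ
  hρ : 0 < ρ
  g : E → ℝ → ℂ
  hg : ∀ e, Continuous (g e)
  ua : E → ℂ
  ub : E → ℂ
  hua : ∀ e, ‖ua e‖ = 1
  hub : ∀ e, ‖ub e‖ = 1
  hg0 : ∀ e, ∀ t ∈ Icc (0:ℝ) 1, g e t = f (A e) + t * ρ * ua e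
  hg2 : ∀ e, ∀ t ∈ Icc (2:ℝ) 3, g e t = f (B e) + (3 - t) * ρ * ub e
  hcore : ∀ e, ∀ t ∈ Icc (1:ℝ) 2, ∀ v, ρ ≤ ‖g e t - f v‖
  hsep : ∀ v w, v ≠ w → 2 * ρ < ‖f v - f w‖
  hdisj : ∀ e e', e ≠ e' → ∀ x ∈ Icc (1:ℝ) 2, ∀ y ∈ Icc (1:ℝ) 2, g e x ≠ g e' y

open Classical in
/-- The mod 2 boundary map. -/
noncomputable def bd {V E : Type*} [Fintype E] (A B : E → V) :
    (E → ZMod 2) →ₗ[ZMod 2] (V → ZMod 2) where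
  toFun z v := ∑ e, z e * ((if A e = v then 1 else 0) + (if B e = v then 1 else 0))
  map_add' z z' := by
    funext v; simp only [Pi.add_apply, add_mul, Finset.sum_add_distrib]
  map_smul' c z := by
    funext v; simp only [Pi.smul_apply, smul_eq_mul, RingHom.id_apply, Finset.mul_sum, mul_assoc]

/-- The mod 2 cycle space. -/
noncomputable def cyc {V E : Type*} [Fintype E] (A B : E → V) : Submodule (ZMod 2) (E → ZMod 2) :=
  LinearMap.ker (bd A B)

theorem cyc_sum {V E : Type*} [Fintype E] [Fintype V] {A B : E → V} {z : E → ZMod 2}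
    (hz : z ∈ cyc A B) (c : V → ZMod 2) : ∑ e, z e * (c (A e) + c (B e)) = 0 := by
  classical
  have h1 : ∀ v, ∑ e, z e * ((if A e = v then 1 else 0) + (if B e = v then 1 else 0)) = 0 := by
    intro v
    have := congrFun (LinearMap.mem_ker.1 hz) v
    simp only [bd, LinearMap.coe_mk, AddHom.coe_mk, Pi.zero_apply] at this
    convert this
  have h2 : ∑ v, c v * ∑ e, z e * ((if A e = v then 1 else 0) + (if B e = v then 1 else 0)) = 0 := by
    simp only [h1, mul_zero, Finset.sum_const_zero]
  rw [← h2]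
  simp only [Finset.mul_sum]
  rw [Finset.sum_comm]
  refine Finset.sum_congr rfl fun e _ => ?_
  have : ∀ v, c v * (z e * ((if A e = v then 1 else 0) + (if B e = v then 1 else 0)))
      = (if A e = v then z e * c v else 0) + (if B e = v then z e * c v else 0) := by
    intro v; split_ifs <;> ring
  simp only [this, Finset.sum_add_distrib, Finset.sum_ite_eq, Finset.mem_univ, if_true]
  ring

theorem near_path {g : ℝ → ℂ} (hg : Continuous g) {m : ℂ} (hm : ∀ t ∈ Icc (0:ℝ) 3, g t ≠ m) :
    ∃ δ > 0, ∀ p q : ℂ, ‖p - m‖ < δ → ‖q - m‖ < δ → ∀ t ∈ Icc (0:ℝ) 3, ‖q - p‖ < ‖g t - p‖ := by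
  obtain ⟨x, hx, hmin⟩ := (isCompact_Icc (a := (0:ℝ)) (b := 3)).exists_isMinOn
    ⟨0, by norm_num⟩ (f := fun t => ‖g t - m‖) (by fun_prop)
  have hpos : 0 < ‖g x - m‖ := norm_pos_iff.2 (sub_ne_zero.2 (hm x hx))
  refine ⟨‖g x - m‖ / 3, by linarith, fun p q hp hq t ht => ?_⟩
  have h1 : ‖g x - m‖ ≤ ‖g t - m‖ := hmin ht
  have h2 : ‖q - p‖ ≤ ‖q - m‖ + ‖p - m‖ := by
    have : q - p = (q - m) - (p - m) := by ring
    rw [this]; exact norm_sub_le _ _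
  have h3 : ‖g t - m‖ ≤ ‖g t - p‖ + ‖p - m‖ := by
    have : g t - m = (g t - p) + (p - m) := by ring
    rw [this]; exact norm_add_le _ _
  linarith

namespace NiceDrawing
variable {V E : Type*} [Fintype V] [Fintype E] (D : NiceDrawing V E)

/-- Winding parity. -/
noncomputable def w (p : ℂ) (z : E → ZMod 2) : ZMod 2 := ∑ e, z e * psg (D.g e) p

theorem w_add (p : ℂ) (z z' : E → ZMod 2) : D.w p (z + z') = D.w p z + D.w p z' := by
  simp only [w, Pi.add_apply, add_mul, Finset.sum_add_distrib]

theorem g_zero (e : E) : D.g e 0 = D.f (D.A e) := by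
  rw [D.hg0 e 0 (by norm_num)]; simp

theorem g_three (e : E) : D.g e 3 = D.f (D.B e) := by
  rw [D.hg2 e 3 (by norm_num)]; simp

theorem w_near {z : E → ZMod 2} (hz : z ∈ cyc D.A D.B) {p q : ℂ}
    (h : ∀ e, z e ≠ 0 → ∀ t ∈ Icc (0:ℝ) 3, ‖q - p‖ < ‖D.g e t - p‖) : D.w q z = D.w p z := by
  have h1 : D.w p z + D.w q z = 0 := by
    rw [← cyc_sum hz (fun v => csg (D.f v) p q)]
    simp only [w, ← Finset.sum_add_distrib, ← mul_add]
    refine Finset.sum_congr rfl fun e _ => ?_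
    by_cases he : z e = 0
    · simp [he]
    · rw [psg_near (D.hg e) (h e he), D.g_zero, D.g_three]
  linear_combination h1 - zmod2_self (D.w p z)

theorem w_jump {z : E → ZMod 2} (hz : z ∈ cyc D.A D.B) {p q : ℂ} (e₀ : E)
    (h : ∀ e, e ≠ e₀ → ∀ t ∈ Icc (0:ℝ) 3, ‖q - p‖ < ‖D.g e t - p‖)
    (h0 : psg (D.g e₀) p + psg (D.g e₀) q = csg (D.g e₀ 0) p q + csg (D.g e₀ 3) p q + 1) :
    D.w p z + D.w q z = z e₀ := by
  classical
  have h2 : D.w p z + D.w q z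
      = ∑ e, (z e * (csg (D.f (D.A e)) p q + csg (D.f (D.B e)) p q) + if e = e₀ then z e else 0) := by
    simp only [w, ← Finset.sum_add_distrib, ← mul_add]
    refine Finset.sum_congr rfl fun e _ => ?_
    by_cases he : e = e₀
    · subst he
      rw [h0, D.g_zero, D.g_three, if_pos rfl]; ring
    · rw [psg_near (D.hg e) (h e he), D.g_zero, D.g_three, if_neg he, add_zero]
  rw [h2, Finset.sum_add_distrib, cyc_sum hz (fun v => csg (D.f v) p q)]
  simp

theorem w_loc {z : E → ZMod 2} (hz : z ∈ cyc D.A D.B) {p : ℂ}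
    (h : ∀ e, z e ≠ 0 → ∀ t ∈ Icc (0:ℝ) 3, D.g e t ≠ p) : ∀ᶠ q in 𝓝 p, D.w q z = D.w p z := by
  have : ∀ e, ∀ᶠ q in 𝓝 p, z e ≠ 0 → ∀ t ∈ Icc (0:ℝ) 3, ‖q - p‖ < ‖D.g e t - p‖ := by
    intro e
    by_cases he : z e = 0
    · simp [he]
    · obtain ⟨δ, hδ, H⟩ := near_path (D.hg e) (h e he)
      filter_upwards [Metric.ball_mem_nhds p hδ] with q hq _
      exact H p q (by simpa using hδ) (by simpa [dist_eq_norm] using hq)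
  filter_upwards [Filter.eventually_all.2 this] with q hq
  exact D.w_near hz hq

/-- The point on the half-radius circle around `v` in direction `θ`. -/
noncomputable def Pt (v : V) (θ : ℝ) : ℂ := D.f v + (D.ρ / 2) * Complex.exp (θ * Complex.I)

theorem Pt_cont (v : V) : Continuous (D.Pt v) := by unfold Pt; fun_prop

open Classical in
/-- The direction in which `e` leaves `v`. -/
noncomputable def dir (e : E) (v : V) : ℂ := if D.A e = v then D.ua e else D.ub e

/-- Incidence. -/
def inc (e : E) (v : V) : Prop := D.A e = v ∨ D.B e = v

theorem norm_dir (e : E) (v : V) : ‖D.dir e v‖ = 1 := by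
  unfold dir; split_ifs
  exacts [D.hua e, D.hub e]

/-- The angle of `e` at `v`. -/
noncomputable def ang (e : E) (v : V) : ℝ := Complex.arg (D.dir e v)

theorem exp_ang (e : E) (v : V) : Complex.exp (D.ang e v * Complex.I) = D.dir e v := by
  have := Complex.norm_mul_exp_arg_mul_I (D.dir e v)
  rw [D.norm_dir] at this
  simpa [ang] using this

theorem dir_A (e : E) : D.dir e (D.A e) = D.ua e := by simp [dir]
theorem dir_B (e : E) : D.dir e (D.B e) = D.ub e := by simp [dir, D.hAB e]

theorem rim {e : E} {v : V} (h : D.inc e v) : ∃ x ∈ Icc (1:ℝ) 2, D.g e x = D.f v + D.ρ * D.dir e v := by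
  rcases h with rfl | rfl
  · refine ⟨1, by norm_num, ?_⟩
    rw [D.hg0 e 1 (by norm_num), D.dir_A]; simp
  · refine ⟨2, by norm_num, ?_⟩
    rw [D.hg2 e 2 (by norm_num), D.dir_B]; push_cast; ring

theorem rep (e : E) {y : ℝ} (hy : y ∈ Icc (0:ℝ) 3) : y ∈ Icc (1:ℝ) 2 ∨
    ∃ v, ∃ r : ℝ, D.inc e v ∧ r ∈ Icc (0:ℝ) 1 ∧ D.g e y = D.f v + r * D.ρ * D.dir e v ∧
      (y ∈ Icc (1/2:ℝ) (5/2) → 1/2 ≤ r) := by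
  rcases le_total y 1 with h1 | h1
  · right
    refine ⟨D.A e, y, Or.inl rfl, ⟨hy.1, h1⟩, ?_, fun h => h.1⟩
    rw [D.hg0 e y ⟨hy.1, h1⟩, D.dir_A]
  · rcases le_total y 2 with h2 | h2
    · exact Or.inl ⟨h1, h2⟩
    · right
      refine ⟨D.B e, 3 - y, Or.inr rfl, ⟨by linarith [hy.2], by linarith⟩, ?_,
        fun h => by linarith [h.2]⟩
      rw [D.hg2 e y ⟨h2, hy.2⟩, D.dir_B]; push_cast; ring

theorem norm_rad (r : ℝ) (hr : 0 ≤ r) (e : E) (v : V) : ‖(r:ℂ) * D.ρ * D.dir e v‖ = r * D.ρ := by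
  rw [norm_mul, norm_mul, D.norm_dir, Complex.norm_real, Complex.norm_real, Real.norm_of_nonneg hr,
    Real.norm_of_nonneg D.hρ.le, mul_one]

theorem dir_inj {e e' : E} {v : V} (h : D.inc e v) (h' : D.inc e' v)
    (hd : D.dir e v = D.dir e' v) : e = e' := by
  by_contra hne
  obtain ⟨x, hx, ex⟩ := D.rim h
  obtain ⟨y, hy, ey⟩ := D.rim h'
  exact D.hdisj e e' hne x hx y hy (by rw [ex, ey, hd])

/-- Separation of radial points. -/
theorem rad_vertex {v w : V} {a b : ℂ} (ha : ‖a‖ ≤ D.ρ) (hb : ‖b‖ ≤ D.ρ)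
    (h : D.f v + a = D.f w + b) : v = w := by
  by_contra hne
  have h1 := D.hsep v w hne
  have : D.f v - D.f w = b - a := by linear_combination h
  rw [this] at h1
  linarith [norm_sub_le b a]

theorem rad_eq {v w : V} {r : ℝ} {e e' : E} {r' : ℝ} (hr : r ∈ Icc (0:ℝ) 1) (hr' : r' ∈ Icc (0:ℝ) 1)
    (hpos : 0 < r)
    (h : D.f v + r * D.ρ * D.dir e v = D.f w + r' * D.ρ * D.dir e' w) :
    v = w ∧ r = r' ∧ D.dir e v = D.dir e' w := by
  have hρ := D.hρ
  have hv : v = w := D.rad_vertex (by rw [D.norm_rad r hr.1]; nlinarith [hr.2])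
    (by rw [D.norm_rad r' hr'.1]; nlinarith [hr'.2]) h
  subst hv
  have h2 : (r:ℂ) * D.ρ * D.dir e v = r' * D.ρ * D.dir e' v := by linear_combination h
  have h3 := congrArg norm h2
  rw [D.norm_rad r hr.1, D.norm_rad r' hr'.1] at h3
  have h4 : r = r' := mul_right_cancel₀ hρ.ne' h3
  subst h4
  refine ⟨rfl, rfl, ?_⟩
  have : (r:ℂ) * D.ρ ≠ 0 := by
    apply mul_ne_zero <;> simp [hpos.ne', hρ.ne']
  exact mul_left_cancel₀ this h2

theorem disj {e e' : E} (hne : e ≠ e') {x y : ℝ} (hx : x ∈ Icc (1/2:ℝ) (5/2))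
    (hy : y ∈ Icc (0:ℝ) 3) : D.g e x ≠ D.g e' y := by
  have hρ := D.hρ
  intro heq
  -- a radial point equal to a core point is on the rim
  have key : ∀ (e e' : E), e ≠ e' → ∀ v r, D.inc e v → r ∈ Icc (0:ℝ) 1 → ∀ y ∈ Icc (1:ℝ) 2,
      D.f v + r * D.ρ * D.dir e v ≠ D.g e' y := by
    intro e e' hne v r hi hr y hy h
    have h1 := D.hcore e' y hy v
    rw [← h, add_sub_cancel_left, D.norm_rad r hr.1] at h1
    have h2 : r = 1 := le_antisymm hr.2 (by nlinarith)
    obtain ⟨x, hx, ex⟩ := D.rim hi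
    refine D.hdisj e e' hne x hx y hy ?_
    rw [ex, ← h, h2]; simp
  have hx' : x ∈ Icc (0:ℝ) 3 := ⟨by linarith [hx.1], by linarith [hx.2]⟩
  rcases D.rep e hx' with cx | ⟨v, r, hi, hr, hv, hr2⟩ <;>
    rcases D.rep e' hy with cy | ⟨v', r', hi', hr', hv', -⟩
  · exact D.hdisj e e' hne x cx y cy heq
  · exact key e' e hne.symm v' r' hi' hr' x cx (by rw [← hv', heq])
  · exact key e e' hne v r hi hr y cy (by rw [← hv, heq])
  · obtain ⟨rfl, -, hd⟩ := D.rad_eq hr hr' (by linarith [hr2 hx]) (by rw [← hv, ← hv', heq])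
    exact hne (D.dir_inj hi hi' hd)

theorem norm_Pt (v : V) (θ : ℝ) : ‖D.Pt v θ - D.f v‖ = D.ρ / 2 := by
  unfold Pt
  rw [add_sub_cancel_left, norm_mul, Complex.norm_exp_ofReal_mul_I, mul_one]
  have : ((D.ρ:ℂ) / 2) = ((D.ρ / 2 : ℝ) : ℂ) := by push_cast; rfl
  rw [this, Complex.norm_real, Real.norm_of_nonneg (by linarith [D.hρ])]

theorem Pt_on {v : V} {θ : ℝ} {e : E} {t : ℝ} (ht : t ∈ Icc (0:ℝ) 3) (h : D.g e t = D.Pt v θ) :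
    D.inc e v ∧ Complex.exp (θ * Complex.I) = D.dir e v := by
  have hρ := D.hρ
  rcases D.rep e ht with c | ⟨w, r, hi, hr, hv, -⟩
  · have := D.hcore e t c v
    rw [h, D.norm_Pt] at this
    linarith
  · have h1 : D.f w + r * D.ρ * D.dir e w = D.f v + (D.Pt v θ - D.f v) := by
      rw [← hv, h]; ring
    have hw := D.rad_vertex (by rw [D.norm_rad r hr.1]; nlinarith [hr.2])
      (by rw [D.norm_Pt]; linarith) h1
    subst hw
    refine ⟨hi, ?_⟩
    have h2 : (r:ℂ) * D.ρ * D.dir e w = D.Pt w θ - D.f w := by linear_combination h1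
    have h3 := congrArg norm h2
    rw [D.norm_rad r hr.1, D.norm_Pt] at h3
    have h4 : r = 1/2 := by
      apply mul_right_cancel₀ hρ.ne'; linarith
    rw [h4] at h2
    unfold Pt at h2
    have h5 : (D.ρ : ℂ) ≠ 0 := by simp [hρ.ne']
    have h6 : (D.ρ : ℂ) * D.dir e w = D.ρ * Complex.exp (θ * Complex.I) := by
      push_cast at h2
      linear_combination 2 * h2
    exact (mul_left_cancel₀ h5 h6).symm

theorem Pt_ang_A (e : E) : D.Pt (D.A e) (D.ang e (D.A e)) = D.g e (1/2) := by
  unfold Pt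
  rw [D.exp_ang, D.dir_A, D.hg0 e _ (by norm_num)]; push_cast; ring

theorem Pt_ang_B (e : E) : D.Pt (D.B e) (D.ang e (D.B e)) = D.g e (5/2) := by
  unfold Pt
  rw [D.exp_ang, D.dir_B, D.hg2 e _ (by norm_num)]; push_cast; ring

/-- Winding parities do not change along an edge outside of the cycle. -/
theorem w_along {z : E → ZMod 2} (hz : z ∈ cyc D.A D.B) {e : E} (he : z e = 0) :
    D.w (D.Pt (D.A e) (D.ang e (D.A e))) z = D.w (D.Pt (D.B e) (D.ang e (D.B e))) z := by
  rw [D.Pt_ang_A, D.Pt_ang_B]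
  refine const_on_Icc (φ := fun t => D.w (D.g e t) z) (by norm_num) fun t ht => ?_
  have := D.w_loc hz (p := D.g e t) (by
    intro e' he' y hy h
    exact D.disj (e := e) (e' := e') (by rintro rfl; exact he' he) ht hy h.symm)
  exact (D.hg e).continuousAt.eventually this

/-- Near an edge outside of the cycle. -/
theorem w_side {z : E → ZMod 2} (hz : z ∈ cyc D.A D.B) {e : E} (he : z e = 0) {v : V}
    (hi : D.inc e v) : ∀ᶠ ε in 𝓝[>] (0:ℝ),
    D.w (D.Pt v (D.ang e v - ε)) z = D.w (D.Pt v (D.ang e v)) z := by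
  have := D.w_loc hz (p := D.Pt v (D.ang e v)) (by
    intro e' he' y hy h
    obtain ⟨h1, h2⟩ := D.Pt_on hy h
    rw [D.exp_ang] at h2
    have := D.dir_inj hi h1 h2
    subst this
    exact he' he)
  have hc : Continuous fun ε : ℝ => D.Pt v (D.ang e v - ε) := (D.Pt_cont v).comp (by fun_prop)
  have h2 : Tendsto (fun ε : ℝ => D.Pt v (D.ang e v - ε)) (𝓝[>] 0) (𝓝 (D.Pt v (D.ang e v))) := by
    have := (hc.tendsto 0).mono_left (nhdsWithin_le_nhds (s := Ioi 0))
    simpa using this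
  exact h2.eventually this

end NiceDrawing


open Set Filter Topology
set_option linter.unusedSectionVars false

namespace NiceDrawing
variable {V E : Type*} [Fintype V] [Fintype E] (D : NiceDrawing V E)

theorem far {v w : V} (hvw : v ≠ w) {x : ℂ} (hx : ‖x - D.f w‖ ≤ D.ρ) : D.ρ ≤ ‖x - D.f v‖ := by
  have h1 := D.hsep v w hvw
  have : D.f v - D.f w = (x - D.f w) - (x - D.f v) := by ring
  rw [this] at h1
  linarith [norm_sub_le (x - D.f w) (x - D.f v)]

theorem Pt_pm_dist (e : E) (v : V) {ε : ℝ} (h0 : 0 < ε) (h1 : ε < 1/2) :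
    ‖D.Pt v (D.ang e v + ε) - D.Pt v (D.ang e v - ε)‖ < D.ρ / 2 := by
  have hρ := D.hρ
  have hd : ∀ s : ℝ, ‖Complex.exp ((D.ang e v + s : ℝ) * Complex.I)
      - Complex.exp ((D.ang e v : ℝ) * Complex.I)‖ ≤ |s| := by
    intro s
    have : Complex.exp ((D.ang e v + s : ℝ) * Complex.I) - Complex.exp ((D.ang e v : ℝ) * Complex.I)
      = Complex.exp ((D.ang e v : ℝ) * Complex.I) * (Complex.exp (Complex.I * s) - 1) := by
      rw [mul_sub, ← Complex.exp_add]; push_cast; ring_nf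
    rw [this, norm_mul, Complex.norm_exp_ofReal_mul_I, one_mul]
    exact Real.norm_exp_I_mul_ofReal_sub_one_le
  have e1 := hd ε
  have e2 := hd (-ε)
  rw [abs_of_pos h0] at e1
  rw [abs_neg, abs_of_pos h0, ← sub_eq_add_neg] at e2
  have h3 : D.Pt v (D.ang e v + ε) - D.Pt v (D.ang e v - ε) = ((D.ρ / 2 : ℝ) : ℂ) *
      ((Complex.exp ((D.ang e v + ε : ℝ) * Complex.I) - Complex.exp ((D.ang e v : ℝ) * Complex.I))
      - (Complex.exp ((D.ang e v - ε : ℝ) * Complex.I) - Complex.exp ((D.ang e v : ℝ) * Complex.I))) := by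
    unfold Pt; push_cast; ring
  rw [h3, norm_mul, Complex.norm_real, Real.norm_of_nonneg (by linarith)]
  have := norm_sub_le (Complex.exp ((D.ang e v + ε : ℝ) * Complex.I) - Complex.exp ((D.ang e v : ℝ) * Complex.I))
    (Complex.exp ((D.ang e v - ε : ℝ) * Complex.I) - Complex.exp ((D.ang e v : ℝ) * Complex.I))
  nlinarith

/-- The edge itself does not pass through the two side points. -/
theorem side_off (e : E) (v : V) {ε : ℝ} (h0 : ε ≠ 0) (h1 : |ε| < 1/2) :
    ∀ t ∈ Icc (0:ℝ) 3, D.g e t ≠ D.Pt v (D.ang e v + ε) := by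
  intro t ht h
  obtain ⟨-, h2⟩ := D.Pt_on ht h
  rw [← D.exp_ang] at h2
  have h3 : Complex.exp (ε * Complex.I) = 1 := by
    have : Complex.exp ((D.ang e v + ε : ℝ) * Complex.I)
      = Complex.exp (D.ang e v * Complex.I) * Complex.exp (ε * Complex.I) := by
      rw [← Complex.exp_add]; push_cast; ring_nf
    rw [this] at h2
    exact mul_left_cancel₀ (Complex.exp_ne_zero _) (h2.trans (mul_one _).symm)
  have h4 := congrArg Complex.im h3
  rw [Complex.exp_ofReal_mul_I_im, Complex.one_im] at h4
  have hpi := Real.pi_gt_three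
  rcases lt_or_gt_of_ne h0 with h | h
  · rw [abs_of_neg h] at h1
    exact absurd h4 (Real.sin_neg_of_neg_of_neg_pi_lt h (by linarith)).ne
  · rw [abs_of_pos h] at h1
    exact absurd h4 (Real.sin_pos_of_pos_of_lt_pi h (by linarith)).ne'

theorem half_far {v : V} {θ : ℝ} {x : ℂ} (hx : D.ρ ≤ ‖x - D.f v‖) : D.ρ / 2 ≤ ‖x - D.Pt v θ‖ := by
  have h1 := D.norm_Pt v θ
  have : x - D.f v = (x - D.Pt v θ) + (D.Pt v θ - D.f v) := by ring
  rw [this] at hx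
  linarith [norm_add_le (x - D.Pt v θ) (D.Pt v θ - D.f v)]

theorem jump_own {e : E} {v : V} (hi : D.inc e v) {ε : ℝ} (h0 : 0 < ε) (h1 : ε < 1/2) :
    psg (D.g e) (D.Pt v (D.ang e v - ε)) + psg (D.g e) (D.Pt v (D.ang e v + ε))
      = csg (D.g e 0) (D.Pt v (D.ang e v - ε)) (D.Pt v (D.ang e v + ε))
        + csg (D.g e 3) (D.Pt v (D.ang e v - ε)) (D.Pt v (D.ang e v + ε)) + 1 := by
  have hρ := D.hρ
  have hdist := D.Pt_pm_dist e v h0 h1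
  have hp := D.side_off e v (ε := -ε) (by linarith) (by rw [abs_neg, abs_of_pos h0]; exact h1)
  have hq := D.side_off e v (ε := ε) h0.ne' (by rw [abs_of_pos h0]; exact h1)
  rw [← sub_eq_add_neg] at hp
  have hf : ∀ θ, ‖D.f v - D.Pt v θ‖ = D.ρ / 2 := fun θ => by rw [norm_sub_rev]; exact D.norm_Pt v θ
  have hcos0 : 0 < Real.cos ε := Real.cos_pos_of_mem_Ioo
    ⟨by linarith [Real.pi_gt_three], by linarith [Real.pi_gt_three]⟩
  have hcos1 := Real.cos_le_one ε
  have em : Complex.exp ((D.ang e v - ε : ℝ) * Complex.I) = D.dir e v * Complex.exp (-ε * Complex.I) := by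
    rw [← D.exp_ang, ← Complex.exp_add]; push_cast; ring_nf
  have ep : Complex.exp ((D.ang e v + ε : ℝ) * Complex.I) = D.dir e v * Complex.exp (ε * Complex.I) := by
    rw [← D.exp_ang, ← Complex.exp_add]; push_cast; ring_nf
  have hconj : (starRingEnd ℂ) (Complex.exp (-ε * Complex.I)) = Complex.exp (ε * Complex.I) := by
    rw [← Complex.exp_conj]; simp
  have hre : (Complex.exp (-ε * Complex.I)).re = Real.cos ε := by
    have := Complex.exp_ofReal_mul_I_re (-ε)
    rw [Real.cos_neg] at this
    rw [← this]; push_cast; rfl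
  have hre2 : ∀ x : ℝ, ((x:ℂ) - 1/2 * Complex.exp (-ε * Complex.I)).re = x - 1/2 * Real.cos ε := by
    intro x
    rw [← hre, Complex.sub_re, Complex.ofReal_re]
    congr 1
    have : (1/2 : ℂ) = ((1/2:ℝ) : ℂ) := by push_cast; rfl
    rw [this, Complex.re_ofReal_mul]
  rcases hi with rfl | rfl
  · refine psg_jump (D.hg e) (c := 0) (d := 1) le_rfl (by norm_num) (by norm_num) hp hq ?_ ?_
      (D.ρ * D.dir e (D.A e)) (fun t => (t:ℂ) - 1/2 * Complex.exp (-ε * Complex.I))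
      (by fun_prop) ?_ ?_ ?_
    · intro t ht
      obtain rfl : t = 0 := le_antisymm ht.2 ht.1
      rw [D.g_zero, hf]; exact hdist
    · intro t ht
      refine hdist.trans_le (D.half_far ?_)
      rcases le_total t 2 with h | h
      · exact D.hcore e t ⟨ht.1, h⟩ _
      · refine D.far (w := D.B e) (D.hAB e) ?_
        rw [D.hg2 e t ⟨h, ht.2⟩, add_sub_cancel_left, ← D.dir_B]
        have := D.norm_rad (3 - t) (by linarith [ht.2]) e (D.B e)
        push_cast at this
        rw [this]; nlinarith
    · intro t ht
      rw [D.hg0 e t ht, ← D.dir_A]; unfold Pt; rw [em]; ring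
    · intro t ht
      rw [D.hg0 e t ht, ← D.dir_A]; unfold Pt; rw [ep, ← hconj]
      simp only [map_sub, map_mul, Complex.conj_ofReal, map_div₀, map_one, map_ofNat]
      ring
    · rw [hre2, hre2]; nlinarith
  · refine psg_jump (D.hg e) (c := 2) (d := 3) (by norm_num) (by norm_num) le_rfl hp hq ?_ ?_
      (D.ρ * D.dir e (D.B e)) (fun t => ((3 - t : ℝ):ℂ) - 1/2 * Complex.exp (-ε * Complex.I))
      (by fun_prop) ?_ ?_ ?_
    · intro t ht
      refine hdist.trans_le (D.half_far ?_)
      rcases le_total 1 t with h | h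
      · exact D.hcore e t ⟨h, ht.2⟩ _
      · refine D.far (w := D.A e) (D.hAB e).symm ?_
        rw [D.hg0 e t ⟨ht.1, h⟩, add_sub_cancel_left, ← D.dir_A]
        rw [D.norm_rad t ht.1 e (D.A e)]; nlinarith
    · intro t ht
      obtain rfl : t = 3 := le_antisymm ht.2 ht.1
      rw [D.g_three, hf]; exact hdist
    · intro t ht
      rw [D.hg2 e t ht, ← D.dir_B]; unfold Pt; rw [em]; push_cast; ring
    · intro t ht
      rw [D.hg2 e t ht, ← D.dir_B]; unfold Pt; rw [ep, ← hconj]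
      simp only [map_sub, map_mul, Complex.conj_ofReal, map_div₀, map_one, map_ofNat]
      push_cast
      ring
    · rw [hre2, hre2]; nlinarith

theorem w_cross {e : E} {v : V} (hi : D.inc e v) : ∀ᶠ ε in 𝓝[>] (0:ℝ), ∀ z ∈ cyc D.A D.B,
    D.w (D.Pt v (D.ang e v - ε)) z + D.w (D.Pt v (D.ang e v + ε)) z = z e := by
  have h : ∀ e', ∀ᶠ ε in 𝓝[>] (0:ℝ), e' ≠ e → ∀ t ∈ Icc (0:ℝ) 3,
      ‖D.Pt v (D.ang e v + ε) - D.Pt v (D.ang e v - ε)‖ < ‖D.g e' t - D.Pt v (D.ang e v - ε)‖ := by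
    intro e'
    by_cases he : e' = e
    · simp [he]
    · obtain ⟨δ, hδ, H⟩ := near_path (D.hg e') (m := D.Pt v (D.ang e v)) (by
        intro y hy h
        obtain ⟨h1, h2⟩ := D.Pt_on hy h
        rw [D.exp_ang] at h2
        exact he (D.dir_inj hi h1 h2).symm)
      have T : ∀ c : ℝ, ∀ᶠ ε in 𝓝[>] (0:ℝ), ‖D.Pt v (D.ang e v + c * ε) - D.Pt v (D.ang e v)‖ < δ := by
        intro c
        have hc : Continuous fun ε : ℝ => ‖D.Pt v (D.ang e v + c * ε) - D.Pt v (D.ang e v)‖ :=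
          (((D.Pt_cont v).comp (by fun_prop)).sub continuous_const).norm
        refine nhdsWithin_le_nhds ((hc.tendsto 0).eventually (gt_mem_nhds ?_))
        simpa using hδ
      filter_upwards [T 1, T (-1)] with ε h1 h2 _
      rw [one_mul] at h1
      rw [neg_one_mul, ← sub_eq_add_neg] at h2
      exact H _ _ h2 h1
  have e1 : ∀ᶠ ε in 𝓝[>] (0:ℝ), ε < 1/2 :=
      mem_nhdsWithin_of_mem_nhds (gt_mem_nhds (by norm_num))
  filter_upwards [Filter.eventually_all.2 h, e1, self_mem_nhdsWithin] with ε h1 h2 h3 z hz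
  exact D.w_jump hz e h1 (D.jump_own hi h3 h2)

/-- The functional at a point of the circle around a vertex. -/
noncomputable def Wf (v : V) (θ : ℝ) : cyc D.A D.B → ZMod 2 := fun z => D.w (D.Pt v θ) z

theorem Wf_loc {v : V} {t : ℝ} (ht : ∀ e, D.inc e v → Complex.exp (t * Complex.I) ≠ D.dir e v) :
    ∀ᶠ s in 𝓝 t, D.Wf v s = D.Wf v t := by
  have : ∀ z : cyc D.A D.B, ∀ᶠ s in 𝓝 t, D.Wf v s z = D.Wf v t z := by
    intro z
    have := D.w_loc z.2 (p := D.Pt v t) (by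
      intro e _ y hy h
      obtain ⟨h1, h2⟩ := D.Pt_on hy h
      exact ht e h1 h2)
    exact (D.Pt_cont v).continuousAt.eventually this
  filter_upwards [Filter.eventually_all.2 this] with s hs
  exact funext hs

open Classical in
theorem around (v : V) (h : (cyc D.A D.B → ZMod 2) → ZMod 2) : ∀ᶠ ε in 𝓝[>] (0:ℝ),
    ∑ e with D.inc e v, (h (D.Wf v (D.ang e v - ε)) + h (D.Wf v (D.ang e v + ε))) = 0 := by
  set F : Finset ℝ := (Finset.univ.filter fun e => D.inc e v).image fun e => D.ang e v with hF
  have hFm : ∀ θ ∈ F, -Real.pi < θ ∧ θ ≤ Real.pi := by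
    intro θ hθ
    obtain ⟨e, -, rfl⟩ := Finset.mem_image.1 hθ
    exact ⟨Complex.neg_pi_lt_arg _, Complex.arg_le_pi _⟩
  have hη : ∀ᶠ η in 𝓝[>] (0:ℝ), (∀ θ ∈ F, -Real.pi + η < θ) ∧ 0 < η := by
    refine Filter.Eventually.and ?_ self_mem_nhdsWithin
    rw [Filter.eventually_all_finset]
    intro θ hθ
    refine mem_nhdsWithin_of_mem_nhds ?_
    filter_upwards [gt_mem_nhds (show (0:ℝ) < θ + Real.pi by linarith [(hFm θ hθ).1])] with x hx
    linarith
  obtain ⟨η, h1, h2⟩ := hη.exists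
  have tel := telescope (fun t => h (D.Wf v t)) F (-Real.pi + η) (Real.pi + η)
    (by linarith [Real.pi_pos])
    (fun θ hθ => ⟨h1 θ hθ, by linarith [(hFm θ hθ).2]⟩) (by
      intro t ht htF
      refine (D.Wf_loc ?_).mono fun s hs => by rw [hs]
      intro e he hexp
      have hθ : D.ang e v ∈ F := Finset.mem_image.2 ⟨e, by simpa using he, rfl⟩
      rw [← D.exp_ang, Complex.exp_eq_exp_iff_exists_int] at hexp
      obtain ⟨n, hn⟩ := hexp
      have hn' : t = D.ang e v + n * (2 * Real.pi) := by
        have h3 : (t:ℂ) = D.ang e v + n * (2 * Real.pi) := by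
          apply mul_right_cancel₀ Complex.I_ne_zero
          rw [hn]; ring
        exact_mod_cast h3
      have b1 := h1 _ hθ
      have b2 := (hFm _ hθ).2
      have hpi := Real.pi_pos
      have n1 : (n:ℝ) < 1 := by
        by_contra hc
        push Not at hc
        nlinarith [ht.2]
      have n2 : (-1:ℝ) < n := by
        by_contra hc
        push Not at hc
        nlinarith [ht.1]
      have n0 : n = 0 := by
        have n1' : n < 1 := by exact_mod_cast n1
        have n2' : -1 < n := by exact_mod_cast n2
        omega
      rw [n0] at hn'
      simp only [Int.cast_zero, zero_mul, add_zero] at hn'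
      exact htF (hn' ▸ hθ))
  have per : D.Wf v (-Real.pi + η) = D.Wf v (Real.pi + η) := by
    have : D.Pt v (-Real.pi + η) = D.Pt v (Real.pi + η) := by
      unfold Pt
      congr 2
      rw [Complex.exp_eq_exp_iff_exists_int]
      exact ⟨-1, by push_cast; ring⟩
    unfold Wf
    rw [this]
  filter_upwards [tel] with ε hε
  rw [per, zmod2_self, hF, Finset.sum_image] at hε
  · exact hε
  · intro e he e' he' hh
    simp only [Finset.coe_filter, Finset.mem_univ, true_and, Set.mem_ofPred_eq] at he he'
    refine D.dir_inj he he' ?_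
    simp only at hh
    rw [← D.exp_ang, ← D.exp_ang, hh]

/-- A two-fold generating system of the cycle space. -/
theorem exists_two_basis : ∃ lam mu : E → (cyc D.A D.B → ZMod 2),
    (∀ e z, lam e z + mu e z = (z : E → ZMod 2) e) ∧
    ∀ h : (cyc D.A D.B → ZMod 2) → ZMod 2, (fun e => h (lam e) + h (mu e)) ∈ cyc D.A D.B := by
  classical
  have c1 : ∀ᶠ ε in 𝓝[>] (0:ℝ), ∀ v, ∀ h : (cyc D.A D.B → ZMod 2) → ZMod 2,
      ∑ e with D.inc e v, (h (D.Wf v (D.ang e v - ε)) + h (D.Wf v (D.ang e v + ε))) = 0 := by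
    rw [Filter.eventually_all]; intro v
    rw [Filter.eventually_all]; intro h
    convert D.around v h
  have c2 : ∀ᶠ ε in 𝓝[>] (0:ℝ), ∀ v, ∀ e, D.inc e v → ∀ z ∈ cyc D.A D.B,
      D.w (D.Pt v (D.ang e v - ε)) z + D.w (D.Pt v (D.ang e v + ε)) z = z e := by
    rw [Filter.eventually_all]; intro v
    rw [Filter.eventually_all]; intro e
    by_cases hi : D.inc e v
    · filter_upwards [D.w_cross hi] with ε h _; exact h
    · exact Eventually.of_forall fun _ h => absurd h hi
  have c3 : ∀ᶠ ε in 𝓝[>] (0:ℝ), ∀ v, ∀ e, D.inc e v → ∀ z : cyc D.A D.B, (z : E → ZMod 2) e = 0 →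
      D.w (D.Pt v (D.ang e v - ε)) z = D.w (D.Pt v (D.ang e v)) z := by
    rw [Filter.eventually_all]; intro v
    rw [Filter.eventually_all]; intro e
    by_cases hi : D.inc e v
    · have : ∀ᶠ ε in 𝓝[>] (0:ℝ), ∀ z : cyc D.A D.B, (z : E → ZMod 2) e = 0 →
          D.w (D.Pt v (D.ang e v - ε)) z = D.w (D.Pt v (D.ang e v)) z := by
        rw [Filter.eventually_all]; intro z
        by_cases hz : (z : E → ZMod 2) e = 0
        · filter_upwards [D.w_side z.2 hz hi] with ε h _; exact h
        · exact Eventually.of_forall fun _ h => absurd h hz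
      filter_upwards [this] with ε h _; exact h
    · exact Eventually.of_forall fun _ h => absurd h hi
  obtain ⟨ε, h1, h2, h3⟩ := (c1.and (c2.and c3)).exists
  have sym : ∀ e, ∀ h : (cyc D.A D.B → ZMod 2) → ZMod 2,
      h (D.Wf (D.A e) (D.ang e (D.A e) - ε)) + h (D.Wf (D.A e) (D.ang e (D.A e) + ε))
      = h (D.Wf (D.B e) (D.ang e (D.B e) - ε)) + h (D.Wf (D.B e) (D.ang e (D.B e) + ε)) := by
    intro e h
    set l := D.Wf (D.A e) (D.ang e (D.A e) - ε) with hl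
    set m := D.Wf (D.A e) (D.ang e (D.A e) + ε) with hm
    set l' := D.Wf (D.B e) (D.ang e (D.B e) - ε) with hl'
    set m' := D.Wf (D.B e) (D.ang e (D.B e) + ε) with hm'
    have s1 : ∀ z : cyc D.A D.B, l z + m z = (z : E → ZMod 2) e := fun z =>
      h2 _ e (Or.inl rfl) z z.2
    have s2 : ∀ z : cyc D.A D.B, l' z + m' z = (z : E → ZMod 2) e := fun z =>
      h2 _ e (Or.inr rfl) z z.2
    have s3 : ∀ z : cyc D.A D.B, (z : E → ZMod 2) e = 0 → l z = l' z := by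
      intro z hz
      have a1 := h3 _ e (Or.inl rfl) z hz
      have a2 := h3 _ e (Or.inr rfl) z hz
      have a3 := D.w_along z.2 hz
      exact a1.trans (a3.trans a2.symm)
    have ladd : ∀ z z' : cyc D.A D.B, l (z + z') = l z + l z' := fun z z' => D.w_add _ _ _
    have ladd' : ∀ z z' : cyc D.A D.B, l' (z + z') = l' z + l' z' := fun z z' => D.w_add _ _ _
    have fin2 : ∀ a b c d x : ZMod 2, a + b = x → c + d = x → a = c → b = d := by decide
    by_cases hll : l = l'
    · have hmm : m = m' := funext fun z => fin2 _ _ _ _ _ (s1 z) (s2 z) (congrFun hll z)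
      rw [hll, hmm]
    · obtain ⟨z0, hz0⟩ : ∃ z, l z ≠ l' z := by
        by_contra hc
        push Not at hc
        exact hll (funext hc)
      have e0 : (z0 : E → ZMod 2) e ≠ 0 := fun h0 => hz0 (s3 z0 h0)
      have fin3 : ∀ x y : ZMod 2, x ≠ 0 → y ≠ 0 → x + y = 0 := by decide
      have fin4 : ∀ a b c d x y u : ZMod 2, a ≠ b → c + a = d + b → c + x = u → d + y = u → u ≠ 0 →
        x = d := by decide
      have fin5 : ∀ a b c d : ZMod 2, a + b = 0 → a = c → b = c := by decide
      have hml : m = l' := by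
        funext z
        by_cases hz : (z : E → ZMod 2) e = 0
        · exact fin5 _ _ _ (l' z) ((s1 z).trans hz) (s3 z hz)
        · have := s3 (z + z0) (fin3 _ _ hz e0)
          rw [ladd, ladd'] at this
          exact fin4 _ _ _ _ _ _ _ hz0 this (s1 z) (s2 z) hz
      have hlm : m' = l := by
        funext z
        have q1 := s1 z
        have q2 := s2 z
        rw [hml, add_comm] at q1
        exact fin2 _ _ _ _ _ q2 q1 rfl
      rw [hml, hlm, add_comm]
  refine ⟨fun e => D.Wf (D.A e) (D.ang e (D.A e) - ε), fun e => D.Wf (D.A e) (D.ang e (D.A e) + ε),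
    fun e z => h2 _ e (Or.inl rfl) z z.2, fun h => ?_⟩
  rw [cyc, LinearMap.mem_ker]
  funext v
  simp only [bd, LinearMap.coe_mk, AddHom.coe_mk, Pi.zero_apply]
  have h1' := h1 v h
  rw [Finset.sum_filter] at h1'
  refine Eq.trans ?_ h1'
  refine Finset.sum_congr rfl fun e _ => ?_
  by_cases hA : D.A e = v
  · have hB : D.B e ≠ v := fun hB => D.hAB e (hA.trans hB.symm)
    rw [if_pos (show D.inc e v from Or.inl hA), if_pos hA, if_neg hB, add_zero, mul_one]
    subst hA; rfl
  · by_cases hB : D.B e = v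
    · rw [if_pos (show D.inc e v from Or.inr hB), if_pos hB, if_neg hA, zero_add, mul_one, sym e h]
      subst hB; rfl
    · rw [if_neg (show ¬ D.inc e v from fun h => h.elim hA hB), if_neg hA, if_neg hB, add_zero, mul_zero]

/-- Girth bound on the dimension of the cycle space. -/
theorem girth_bound (k : ℕ)
    (hk : ∀ z ∈ cyc D.A D.B, z ≠ 0 → k ≤ (Finset.univ.filter fun e => z e ≠ 0).card) :
    k * Module.finrank (ZMod 2) (cyc D.A D.B) ≤ 2 * Fintype.card E := by
  classical
  obtain ⟨lam, mu, h1, h2⟩ := D.exists_two_basis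
  let δ : (cyc D.A D.B → ZMod 2) → (E → ZMod 2) := fun φ e =>
    (if lam e = φ then 1 else 0) + (if mu e = φ then 1 else 0)
  have hδ : ∀ φ, δ φ ∈ cyc D.A D.B := fun φ => h2 fun x => if x = φ then 1 else 0
  let S : Finset (cyc D.A D.B → ZMod 2) := Finset.univ.filter fun φ => δ φ ≠ 0
  have hspan : cyc D.A D.B ≤ Submodule.span (ZMod 2) (S.image δ : Set (E → ZMod 2)) := by
    intro z hz
    have hzs : z = ∑ φ, φ ⟨z, hz⟩ • δ φ := by
      funext e
      rw [Finset.sum_apply]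
      refine (h1 e ⟨z, hz⟩).symm.trans ?_
      simp only [δ, Pi.smul_apply, smul_eq_mul, mul_add, mul_ite, mul_one, mul_zero,
        Finset.sum_add_distrib, Finset.sum_ite_eq, Finset.mem_univ, if_true]
    rw [hzs]
    refine Submodule.sum_mem _ fun φ _ => Submodule.smul_mem _ _ ?_
    by_cases h0 : δ φ = 0
    · rw [h0]; exact Submodule.zero_mem _
    · exact Submodule.subset_span (by
        rw [Finset.mem_coe]
        exact Finset.mem_image_of_mem _ (by simp [S, h0]))
  have hcard : Module.finrank (ZMod 2) (cyc D.A D.B) ≤ S.card :=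
    (Submodule.finrank_mono hspan).trans ((finrank_span_finset_le_card _).trans Finset.card_image_le)
  have hcount : ∑ φ ∈ S, (Finset.univ.filter fun e => δ φ e ≠ 0).card ≤ 2 * Fintype.card E := by
    have e1 : ∑ φ ∈ S, (Finset.univ.filter fun e => δ φ e ≠ 0).card
        = ∑ e : E, (S.filter fun φ => δ φ e ≠ 0).card := by
      simp only [Finset.card_filter]
      rw [Finset.sum_comm]
    rw [e1]
    have e2 : ∀ e : E, (S.filter fun φ => δ φ e ≠ 0).card ≤ 2 := by
      intro e
      refine (Finset.card_le_card (t := {lam e, mu e}) ?_).trans Finset.card_le_two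
      intro φ hφ
      have hφ := (Finset.mem_filter.1 hφ).2
      by_contra hc
      simp only [Finset.mem_insert, Finset.mem_singleton, not_or] at hc
      apply hφ
      simp only [δ]
      rw [if_neg (Ne.symm hc.1), if_neg (Ne.symm hc.2), add_zero]
    calc _ ≤ ∑ _e : E, 2 := Finset.sum_le_sum fun e _ => e2 e
      _ = 2 * Fintype.card E := by simp [mul_comm]
  calc k * Module.finrank (ZMod 2) (cyc D.A D.B) ≤ k * S.card := Nat.mul_le_mul_left _ hcard
    _ = ∑ φ ∈ S, k := by simp [mul_comm]
    _ ≤ ∑ φ ∈ S, (Finset.univ.filter fun e => δ φ e ≠ 0).card := by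
        refine Finset.sum_le_sum fun φ hφ => hk _ (hδ φ) ?_
        exact (Finset.mem_filter.1 hφ).2
    _ ≤ _ := hcount

end NiceDrawing

/-- Lower bound for the dimension of the cycle space. -/
theorem cyc_dim {V E : Type*} [Fintype E] [Fintype V] (A B : E → V) (U : Finset V)
    (hU : U.Nonempty) (hA : ∀ e, A e ∈ U) (hB : ∀ e, B e ∈ U) :
    Fintype.card E + 1 ≤ U.card + Module.finrank (ZMod 2) (cyc A B) := by
  classical
  obtain ⟨u, hu⟩ := hU
  let R : (V → ZMod 2) →ₗ[ZMod 2] (U.erase u → ZMod 2) := LinearMap.funLeft _ _ Subtype.val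
  have hker : LinearMap.ker (R ∘ₗ bd A B) ≤ cyc A B := by
    intro z hz
    have hz1 : ∀ v ∈ U.erase u, bd A B z v = 0 := fun v hv =>
      congrFun (LinearMap.mem_ker.1 hz) ⟨v, hv⟩
    have hz2 : ∀ v ∉ U, bd A B z v = 0 := by
      intro v hv
      simp only [bd, LinearMap.coe_mk, AddHom.coe_mk]
      refine Finset.sum_eq_zero fun e _ => ?_
      rw [if_neg (fun h : A e = v => hv (h ▸ hA e)), if_neg (fun h : B e = v => hv (h ▸ hB e)), add_zero, mul_zero]
    have hsum : ∑ v, bd A B z v = 0 := by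
      simp only [bd, LinearMap.coe_mk, AddHom.coe_mk]
      rw [Finset.sum_comm]
      refine Finset.sum_eq_zero fun e _ => ?_
      rw [← Finset.mul_sum, Finset.sum_add_distrib]
      simp only [Finset.sum_ite_eq, Finset.mem_univ, if_true]
      rw [zmod2_self, mul_zero]
    have hoff : ∀ v, v ≠ u → bd A B z v = 0 := by
      intro v hv
      by_cases h : v ∈ U
      · exact hz1 v (Finset.mem_erase.2 ⟨hv, h⟩)
      · exact hz2 v h
    rw [cyc, LinearMap.mem_ker]
    funext v
    by_cases hv : v = u
    · subst hv
      rw [Finset.sum_eq_single v (fun w _ hw => hoff w hw) (by simp)] at hsum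
      exact hsum
    · exact hoff v hv
  have h1 := LinearMap.finrank_range_add_finrank_ker (R ∘ₗ bd A B)
  have h2 := Submodule.finrank_mono hker
  have h3 : Module.finrank (ZMod 2) (LinearMap.range (R ∘ₗ bd A B)) ≤ (U.erase u).card := by
    refine (Submodule.finrank_le _).trans ?_
    rw [Module.finrank_pi, Fintype.card_coe]
  have h4 := Finset.card_erase_add_one hu
  rw [Module.finrank_pi] at h1
  omega


open Set Filter Topology

theorem exists_cut {c : ℝ → ℂ} (hc : ContinuousOn c (Icc 0 1)) {ρ : ℝ} (hρ : 0 < ρ) {p q : ℂ}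
    (h0 : c 0 = p) (h1 : c 1 = q) (hpq : 2 * ρ < ‖p - q‖) :
    ∃ s t : ℝ, 0 < s ∧ s < t ∧ t < 1 ∧ ‖c s - p‖ = ρ ∧ ‖c t - q‖ = ρ ∧
      ∀ x ∈ Icc s t, ρ ≤ ‖c x - p‖ ∧ ρ ≤ ‖c x - q‖ := by
  have cp : ContinuousOn (fun x => ‖c x - p‖) (Icc 0 1) := (hc.sub continuousOn_const).norm
  have cq : ContinuousOn (fun x => ‖c x - q‖) (Icc 0 1) := (hc.sub continuousOn_const).norm
  have hS : IsCompact (Icc (0:ℝ) 1 ∩ (fun x => ‖c x - p‖) ⁻¹' Iic ρ) :=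
    isCompact_Icc.of_isClosed_subset (cp.preimage_isClosed_of_isClosed isClosed_Icc isClosed_Iic)
      inter_subset_left
  obtain ⟨s, ⟨hs1, hs2⟩, hs3⟩ := hS.exists_isGreatest ⟨0, ⟨by norm_num, by norm_num⟩, by
    simp [h0, hρ.le]⟩
  simp only [mem_preimage, mem_Iic] at hs2
  have htri : ∀ x, 2 * ρ < ‖c x - p‖ + ‖c x - q‖ := by
    intro x
    have : p - q = (c x - q) - (c x - p) := by ring
    rw [this] at hpq
    linarith [norm_sub_le (c x - q) (c x - p)]
  have hs : ‖c s - p‖ = ρ := by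
    obtain ⟨x, hx, hxρ⟩ := intermediate_value_Icc hs1.2 (cp.mono (Icc_subset_Icc hs1.1 le_rfl))
      (show ρ ∈ _ from ⟨hs2, by
        have := htri 1
        simp only [h1, sub_self, norm_zero, add_zero] at this ⊢
        linarith⟩)
    have : x ≤ s := hs3 ⟨⟨hs1.1.trans hx.1, hx.2⟩, hxρ.le⟩
    obtain rfl : x = s := le_antisymm this hx.1
    exact hxρ
  have hT : IsCompact (Icc s 1 ∩ (fun x => ‖c x - q‖) ⁻¹' Iic ρ) :=
    isCompact_Icc.of_isClosed_subset ((cq.mono (Icc_subset_Icc hs1.1 le_rfl)).preimage_isClosed_of_isClosed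
      isClosed_Icc isClosed_Iic) inter_subset_left
  obtain ⟨t, ⟨ht1, ht2⟩, ht3⟩ := hT.exists_isLeast ⟨1, ⟨hs1.2, le_rfl⟩, by simp [h1, hρ.le]⟩
  simp only [mem_preimage, mem_Iic] at ht2
  have hsq : ρ < ‖c s - q‖ := by linarith [htri s]
  have ht : ‖c t - q‖ = ρ := by
    obtain ⟨x, hx, hxρ⟩ := intermediate_value_Icc' ht1.1
      (cq.mono (Icc_subset_Icc hs1.1 ht1.2)) (show ρ ∈ _ from ⟨ht2, hsq.le⟩)
    have : t ≤ x := ht3 ⟨⟨hx.1, hx.2.trans ht1.2⟩, hxρ.le⟩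
    obtain rfl : x = t := le_antisymm hx.2 this
    exact hxρ
  refine ⟨s, t, lt_of_le_of_ne hs1.1 ?_, lt_of_le_of_ne ht1.1 ?_, lt_of_le_of_ne ht1.2 ?_, hs, ht, ?_⟩
  · rintro rfl
    rw [h0, sub_self, norm_zero] at hs
    exact hρ.ne hs
  · rintro rfl
    exact hsq.ne' ht
  · rintro rfl
    rw [h1, sub_self, norm_zero] at ht
    exact hρ.ne ht
  · intro x hx
    constructor
    · by_contra hlt
      push Not at hlt
      have : x ≤ s := hs3 ⟨⟨hs1.1.trans hx.1, hx.2.trans ht1.2⟩, hlt.le⟩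
      obtain rfl : x = s := le_antisymm this hx.1
      exact hlt.ne hs
    · by_contra hlt
      push Not at hlt
      have : t ≤ x := ht3 ⟨⟨hx.1, hx.2.trans ht1.2⟩, hlt.le⟩
      obtain rfl : x = t := le_antisymm hx.2 this
      exact hlt.ne ht

/-- A path with straight ends. -/
noncomputable def bent (c : ℝ → ℂ) (p q : ℂ) (s t : ℝ) (x : ℝ) : ℂ :=
  if x ≤ 1 then p + x * (c s - p) else
    if x ≤ 2 then c (max 0 (min 1 (s + (x - 1) * (t - s)))) else q + (3 - x) * (c t - q)

theorem bent_cont {c : ℝ → ℂ} (hc : ContinuousOn c (Icc 0 1)) (p q : ℂ) {s t : ℝ}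
    (hs : 0 ≤ s) (hst : s ≤ t) (ht : t ≤ 1) : Continuous (bent c p q s t) := by
  unfold bent
  refine Continuous.if_le (by fun_prop) (Continuous.if_le ?_ (by fun_prop) continuous_id continuous_const ?_)
    continuous_id continuous_const ?_
  · refine hc.comp_continuous (by fun_prop) fun x => ⟨le_max_left _ _, max_le zero_le_one (min_le_left _ _)⟩
  · rintro x rfl
    have : s + (2 - 1) * (t - s) = t := by ring
    rw [this, min_eq_right ht, max_eq_right (hs.trans hst)]
    push_cast; ring
  · rintro x rfl
    have : s + (1 - 1) * (t - s) = s := by ring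
    rw [if_pos (by norm_num), this, min_eq_right (hst.trans ht), max_eq_right hs]
    push_cast; ring

theorem bent_mid {c : ℝ → ℂ} (p q : ℂ) {s t : ℝ}
    (hs : 0 ≤ s) (hst : s ≤ t) (ht : t ≤ 1) {x : ℝ} (hx : x ∈ Icc (1:ℝ) 2) :
    ∃ y ∈ Icc s t, bent c p q s t x = c y := by
  obtain ⟨h1, h2⟩ := hx
  refine ⟨s + (x - 1) * (t - s), ⟨by nlinarith, by nlinarith⟩, ?_⟩
  unfold bent
  split_ifs with h
  · obtain rfl : x = 1 := le_antisymm h h1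
    have : s + (1 - 1) * (t - s) = s := by ring
    rw [this]; push_cast; ring
  · rw [min_eq_right (by nlinarith), max_eq_right (by nlinarith)]

theorem bent_end {c : ℝ → ℂ} (p q : ℂ) {s t : ℝ}
    (hs : 0 ≤ s) (hst : s ≤ t) (ht : t ≤ 1) {x : ℝ} (hx : 2 ≤ x) :
    bent c p q s t x = q + (3 - x) * (c t - q) := by
  unfold bent
  rw [if_neg (by linarith)]
  split_ifs with h
  · obtain rfl : x = 2 := le_antisymm h hx
    have : s + (2 - 1) * (t - s) = t := by ring
    rw [this, min_eq_right ht, max_eq_right (hs.trans hst)]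
    push_cast; ring
  · rfl

theorem SimpleGraph.IsPlanar.mono' {V : Type*} {G H : SimpleGraph V} (h : G.IsPlanar) (hHG : H ≤ G) :
    H.IsPlanar := by
  obtain ⟨f, γ, h1, h2, h3, h4, h5, h6⟩ := h
  have hsub := SimpleGraph.edgeSet_subset_edgeSet.2 hHG
  refine ⟨f, fun e => γ ⟨e, hsub e.2⟩, h1, fun e => h2 _, fun e => h3 _, fun e => h4 ⟨e, hsub e.2⟩,
    fun e => h5 _, fun e e' hne => h6 _ _ ?_⟩
  intro h
  exact hne (Subtype.ext (Subtype.mk.inj h))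

theorem SimpleGraph.IsPlanar.nice {V : Type*} [Fintype V] {H : SimpleGraph V} (h : H.IsPlanar) :
    ∃ D : NiceDrawing V H.edgeSet, ∀ e : H.edgeSet, (e : Sym2 V) = s(D.A e, D.B e) := by
  classical
  obtain ⟨f, γ, h1, h2, h3, h4, h5, h6⟩ := h
  choose A B hAB hA hB using h4
  have hne : ∀ e, A e ≠ B e := by
    intro e he
    have := e.2
    rw [hAB, he] at this
    exact H.loopless.irrefl _ this
  let L := Complex.equivRealProdCLM.symm
  let F : V → ℂ := fun v => L (f v)
  let c : H.edgeSet → ℝ → ℂ := fun e t => L (γ e t)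
  have hF : Function.Injective F := L.injective.comp h1
  have hc : ∀ e, ContinuousOn (c e) (Icc 0 1) := fun e => L.continuous.comp_continuousOn (h2 e)
  have hc0 : ∀ e, c e 0 = F (A e) := fun e => congrArg L (hA e)
  have hc1 : ∀ e, c e 1 = F (B e) := fun e => congrArg L (hB e)
  have hcv : ∀ e, ∀ t ∈ Ioo (0:ℝ) 1, ∀ v, c e t ≠ F v := fun e t ht v hh => h5 e t ht v (L.injective hh)
  have hcd : ∀ e e', e ≠ e' → ∀ t ∈ Ioo (0:ℝ) 1, ∀ t' ∈ Ioo (0:ℝ) 1, c e t ≠ c e' t' :=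
    fun e e' hn t ht t' ht' hh => h6 e e' hn t ht t' ht' (L.injective hh)
  have r1 : ∀ᶠ ρ in 𝓝[>] (0:ℝ), ∀ v w, v ≠ w → 2 * ρ < ‖F v - F w‖ := by
    rw [Filter.eventually_all]; intro v
    rw [Filter.eventually_all]; intro w
    by_cases hvw : v = w
    · exact Eventually.of_forall fun _ h => absurd hvw h
    · have hp : 0 < ‖F v - F w‖ := norm_pos_iff.2 (sub_ne_zero.2 (hF.ne hvw))
      refine mem_nhdsWithin_of_mem_nhds ?_
      filter_upwards [gt_mem_nhds (show (0:ℝ) < ‖F v - F w‖ / 2 by linarith)] with x hx _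
      linarith
  have r2 : ∀ᶠ ρ in 𝓝[>] (0:ℝ), ∀ e v, v ≠ A e → v ≠ B e → ∀ t ∈ Icc (0:ℝ) 1, ρ ≤ ‖c e t - F v‖ := by
    rw [Filter.eventually_all]; intro e
    rw [Filter.eventually_all]; intro v
    by_cases hv : v ≠ A e ∧ v ≠ B e
    · obtain ⟨x, hx, hmin⟩ := isCompact_Icc.exists_isMinOn (nonempty_Icc.2 zero_le_one)
        (((hc e).sub continuousOn_const).norm : ContinuousOn (fun t => ‖c e t - F v‖) (Icc (0:ℝ) 1))
      have hp : 0 < ‖c e x - F v‖ := by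
        rw [norm_pos_iff, sub_ne_zero]
        rcases hx.1.eq_or_lt with rfl | h0
        · rw [hc0]; exact hF.ne hv.1.symm
        · rcases hx.2.eq_or_lt with rfl | h1
          · rw [hc1]; exact hF.ne hv.2.symm
          · exact hcv e x ⟨h0, h1⟩ v
      refine mem_nhdsWithin_of_mem_nhds ?_
      filter_upwards [gt_mem_nhds hp] with ρ hρ _ _ t ht
      exact hρ.le.trans (hmin ht)
    · exact Eventually.of_forall fun _ h h' => absurd ⟨h, h'⟩ hv
  obtain ⟨ρ, r1, r2, hρ⟩ := (r1.and (r2.and self_mem_nhdsWithin)).exists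
  have hρ : 0 < ρ := hρ
  have hcut := fun e => exists_cut (hc e) hρ (hc0 e) (hc1 e) (r1 _ _ (hne e))
  choose s t hs hst ht hsA htB hmid using hcut
  have hρC : (ρ : ℂ) ≠ 0 := by exact_mod_cast hρ.ne'
  refine ⟨{ f := F, A := A, B := B, hAB := hne, ρ := ρ, hρ := hρ,
            g := fun e => bent (c e) (F (A e)) (F (B e)) (s e) (t e)
            hg := fun e => bent_cont (hc e) _ _ (hs e).le (hst e).le (ht e).le
            ua := fun e => (c e (s e) - F (A e)) / ρ
            ub := fun e => (c e (t e) - F (B e)) / ρ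
            hua := fun e => ?_
            hub := fun e => ?_
            hg0 := fun e x hx => ?_
            hg2 := fun e x hx => ?_
            hcore := fun e x hx v => ?_
            hsep := r1
            hdisj := fun e e' hn x hx y hy => ?_ }, fun e => hAB e⟩
  · rw [norm_div, hsA, Complex.norm_real, Real.norm_of_nonneg hρ.le, div_self hρ.ne']
  · rw [norm_div, htB, Complex.norm_real, Real.norm_of_nonneg hρ.le, div_self hρ.ne']
  · unfold bent
    rw [if_pos hx.2]
    field_simp
  · rw [bent_end _ _ (hs e).le (hst e).le (ht e).le hx.1]
    field_simp
  · obtain ⟨y, hy, hyy⟩ := bent_mid (c := c e) (F (A e)) (F (B e)) (hs e).le (hst e).le (ht e).le hx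
    rw [hyy]
    by_cases h1 : v = A e
    · rw [h1]; exact (hmid e y hy).1
    · by_cases h2 : v = B e
      · rw [h2]; exact (hmid e y hy).2
      · exact r2 e v h1 h2 y ⟨(hs e).le.trans hy.1, hy.2.trans (ht e).le⟩
  · obtain ⟨a, ha, haa⟩ := bent_mid (c := c e) (F (A e)) (F (B e)) (hs e).le (hst e).le (ht e).le hx
    obtain ⟨b, hb, hbb⟩ := bent_mid (c := c e') (F (A e')) (F (B e')) (hs e').le (hst e').le (ht e').le hy
    rw [haa, hbb]
    exact hcd e e' hn a ⟨(hs e).trans_le ha.1, ha.2.trans_lt (ht e)⟩ b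
      ⟨(hs e').trans_le hb.1, hb.2.trans_lt (ht e')⟩


open Set Filter Topology

theorem cyc_other {V : Type*} [Fintype V] {H : SimpleGraph V} [Fintype H.edgeSet] {A B : H.edgeSet → V}
    (hAB : ∀ e : H.edgeSet, (e : Sym2 V) = s(A e, B e)) {z : H.edgeSet → ZMod 2} (hz : z ∈ cyc A B)
    {e : H.edgeSet} (he : z e ≠ 0) {v : V} (hv : v ∈ (e : Sym2 V)) :
    ∃ e' : H.edgeSet, e' ≠ e ∧ z e' ≠ 0 ∧ v ∈ (e' : Sym2 V) := by
  classical
  by_contra hc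
  push Not at hc
  have hne : A e ≠ B e := by
    intro h
    have := e.2
    rw [hAB, h] at this
    exact H.loopless.irrefl _ this
  have h1 := congrFun (LinearMap.mem_ker.1 hz) v
  simp only [bd, LinearMap.coe_mk, AddHom.coe_mk, Pi.zero_apply] at h1
  rw [Finset.sum_eq_single e ?_ (by simp)] at h1
  · rw [hAB, Sym2.mem_iff] at hv
    rcases hv with rfl | rfl
    · rw [if_pos rfl, if_neg hne.symm, add_zero, mul_one] at h1
      exact he h1
    · rw [if_pos rfl, if_neg hne, zero_add, mul_one] at h1
      exact he h1
  · intro e' _ hne'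
    by_cases h0 : z e' = 0
    · rw [h0, zero_mul]
    · have := hc e' hne' h0
      rw [hAB, Sym2.mem_iff, not_or] at this
      rw [if_neg (Ne.symm this.1), if_neg (Ne.symm this.2), add_zero, mul_zero]

theorem planar_bound {V : Type*} [Fintype V] {H : SimpleGraph V} (h : H.IsPlanar) (U : Finset V)
    (hU : U.Nonempty) (hHU : ∀ v w, H.Adj v w → v ∈ U) : H.edgeSet.ncard + 3 ≤ 3 * U.card := by
  classical
  obtain ⟨D, hD⟩ := h.nice
  have hA : ∀ e, H.Adj (D.A e) (D.B e) := fun e => by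
    have := e.2; rw [hD, SimpleGraph.mem_edgeSet] at this; exact this
  have h1 := cyc_dim D.A D.B U hU (fun e => hHU _ _ (hA e)) (fun e => hHU _ _ (hA e).symm)
  have h2 := D.girth_bound 3 (by
    intro z hz h0
    obtain ⟨e, he⟩ := Function.ne_iff.1 h0
    obtain ⟨e1, a1, b1, c1⟩ := cyc_other hD hz he (v := D.A e) (by rw [hD]; simp)
    obtain ⟨e2, a2, b2, c2⟩ := cyc_other hD hz he (v := D.B e) (by rw [hD]; simp)
    have h12 : e1 ≠ e2 := by
      rintro rfl
      apply a1
      apply Subtype.ext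
      rw [hD e]
      exact (Sym2.mem_and_mem_iff (D.hAB e)).1 ⟨c1, c2⟩
    rw [← Finset.card_eq_three.2 ⟨e, e1, e2, a1.symm, a2.symm, h12, rfl⟩]
    apply Finset.card_le_card
    intro x hx
    simp only [Finset.mem_insert, Finset.mem_singleton] at hx
    rw [Finset.mem_filter]
    rcases hx with rfl | rfl | rfl
    · exact ⟨Finset.mem_univ _, he⟩
    · exact ⟨Finset.mem_univ _, b1⟩
    · exact ⟨Finset.mem_univ _, b2⟩)
  rw [Set.ncard_eq_toFinset_card', Set.toFinset_card]
  omega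

theorem planar_bip_bound {V : Type*} [Fintype V] {H : SimpleGraph V} (h : H.IsPlanar) (U : Finset V)
    (hU : U.Nonempty) (hHU : ∀ v w, H.Adj v w → v ∈ U) (c : V → Prop)
    (hc : ∀ v w, H.Adj v w → (c v ↔ ¬ c w)) : H.edgeSet.ncard + 2 ≤ 2 * U.card := by
  classical
  obtain ⟨D, hD⟩ := h.nice
  have hA : ∀ e, H.Adj (D.A e) (D.B e) := fun e => by
    have := e.2; rw [hD, SimpleGraph.mem_edgeSet] at this; exact this
  have h1 := cyc_dim D.A D.B U hU (fun e => hHU _ _ (hA e)) (fun e => hHU _ _ (hA e).symm)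
  have h2 := D.girth_bound 4 (by
    intro z hz h0
    obtain ⟨e, he⟩ := Function.ne_iff.1 h0
    obtain ⟨e1, a1, b1, c1⟩ := cyc_other hD hz he (v := D.A e) (by rw [hD]; simp)
    obtain ⟨e2, a2, b2, c2⟩ := cyc_other hD hz he (v := D.B e) (by rw [hD]; simp)
    obtain ⟨x, hx⟩ := Sym2.mem_iff_exists.1 c1
    obtain ⟨y, hy⟩ := Sym2.mem_iff_exists.1 c2
    obtain ⟨e3, a3, b3, c3⟩ := cyc_other hD hz b1 (v := x) (by rw [hx]; simp)
    have k1 : H.Adj (D.A e) x := by have := e1.2; rwa [hx, SimpleGraph.mem_edgeSet] at this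
    have k2 : H.Adj (D.B e) y := by have := e2.2; rwa [hy, SimpleGraph.mem_edgeSet] at this
    have l0 := hc _ _ (hA e)
    have l1 := hc _ _ k1
    have l2 := hc _ _ k2
    have hxy : x ≠ y := by rintro rfl; tauto
    have hxa : x ≠ D.A e := k1.ne'
    have hxb : x ≠ D.B e := by
      rintro rfl
      exact a1 (Subtype.ext (hx.trans (hD e).symm))
    have m1 : e1 ≠ e2 := by
      rintro rfl
      rw [hx, Sym2.mem_iff] at c2
      rcases c2 with c2 | c2
      · exact D.hAB e c2.symm
      · exact hxb c2.symm
    have m2 : e3 ≠ e := by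
      rintro rfl
      rw [hD, Sym2.mem_iff] at c3
      tauto
    have m3 : e3 ≠ e2 := by
      rintro rfl
      rw [hy, Sym2.mem_iff] at c3
      tauto
    have hcard : ({e, e1, e2, e3} : Finset H.edgeSet).card = 4 := by
      rw [Finset.card_insert_of_notMem (by simp [a1.symm, a2.symm, m2.symm]),
        Finset.card_eq_three.2 ⟨e1, e2, e3, m1, a3.symm, m3.symm, rfl⟩]
    rw [← hcard]
    apply Finset.card_le_card
    intro x hx
    simp only [Finset.mem_insert, Finset.mem_singleton] at hx
    rw [Finset.mem_filter]
    rcases hx with rfl | rfl | rfl | rfl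
    · exact ⟨Finset.mem_univ _, he⟩
    · exact ⟨Finset.mem_univ _, b1⟩
    · exact ⟨Finset.mem_univ _, b2⟩
    · exact ⟨Finset.mem_univ _, b3⟩)
  rw [Set.ncard_eq_toFinset_card', Set.toFinset_card]
  omega


open Set Filter Topology

theorem matching_insert {V : Type*} [DecidableEq V] {G : SimpleGraph V} {M : Finset (Sym2 V)} {m : ℕ}
    (hM : IsMatchingOfSize G M m) {a b : V} (hab : G.Adj a b) (ha : ∀ e ∈ M, a ∉ e) (hb : ∀ e ∈ M, b ∉ e) :
    IsMatchingOfSize G (insert s(a, b) M) (m + 1) := by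
  obtain ⟨h1, h2, h3⟩ := hM
  refine ⟨?_, ?_, ?_⟩
  · rw [Finset.card_insert_of_notMem, h1]
    intro h
    exact ha _ h (Sym2.mem_mk_left a b)
  · intro e he
    rw [Finset.coe_insert] at he
    rcases he with rfl | he
    · exact hab
    · exact h2 he
  · intro e he e' he' hne v hv hv'
    rw [Finset.mem_insert] at he he'
    rcases he with rfl | he <;> rcases he' with rfl | he'
    · exact hne rfl
    · rw [Sym2.mem_iff] at hv
      rcases hv with rfl | rfl
      · exact ha _ he' hv'
      · exact hb _ he' hv'
    · rw [Sym2.mem_iff] at hv'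
      rcases hv' with rfl | rfl
      · exact ha _ he hv
      · exact hb _ he hv
    · exact h3 e he e' he' hne v hv hv'

theorem matching_erase {V : Type*} [DecidableEq V] {G : SimpleGraph V} {M : Finset (Sym2 V)} {m : ℕ}
    (hM : IsMatchingOfSize G M m) {e : Sym2 V} (he : e ∈ M) :
    IsMatchingOfSize G (M.erase e) (m - 1) := by
  obtain ⟨h1, h2, h3⟩ := hM
  refine ⟨by rw [Finset.card_erase_of_mem he, h1], ?_, ?_⟩
  · intro x hx
    exact h2 (Finset.mem_of_mem_erase hx)
  · intro x hx y hy
    exact h3 x (Finset.mem_of_mem_erase hx) y (Finset.mem_of_mem_erase hy)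

/-- Edge bound for planar graphs whose largest matching has size `K`. -/
theorem edges_le {V : Type*} [Fintype V] {G : SimpleGraph V} (hG : G.IsPlanar) {K : ℕ} (hK : 0 < K)
    (hn : 2 * K < Fintype.card V) {M : Finset (Sym2 V)} (hM : IsMatchingOfSize G M K)
    (hno : ¬ ∃ M : Finset (Sym2 V), IsMatchingOfSize G M (K + 1)) :
    G.edgeSet.ncard + 5 ≤ 2 * Fintype.card V + 4 * K := by
  classical
  set W : Finset V := M.biUnion Sym2.toFinset with hW
  have memW : ∀ v, v ∈ W ↔ ∃ e ∈ M, v ∈ e := by intro v; simp [hW]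
  have cardW : W.card ≤ 2 * K := by
    rw [hW, ← hM.1, mul_comm]
    refine Finset.card_biUnion_le_card_mul _ _ _ fun e _ => ?_
    induction e with
    | _ a b => rw [Sym2.toFinset_mk_eq]; exact Finset.card_le_two
  have notW : ∀ v, v ∉ W → ∀ e ∈ M, v ∉ e := fun v hv e he h => hv ((memW v).2 ⟨e, he, h⟩)
  have indep : ∀ x y, x ∉ W → y ∉ W → ¬ G.Adj x y := fun x y hx hy h =>
    hno ⟨_, matching_insert hM h (notW x hx) (notW y hy)⟩
  let N : V → Finset V := fun w => Finset.univ.filter fun x => G.Adj w x ∧ x ∉ W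
  have memN : ∀ w x, x ∈ N w ↔ G.Adj w x ∧ x ∉ W := by intro w x; simp [N]
  have aug : ∀ u v, s(u, v) ∈ M → ∀ x ∈ N u, ∀ y ∈ N v, x = y := by
    intro u v huv x hx y hy
    by_contra hxy
    rw [memN] at hx hy
    have huW : u ∈ W := (memW u).2 ⟨_, huv, Sym2.mem_mk_left _ _⟩
    have hvW : v ∈ W := (memW v).2 ⟨_, huv, Sym2.mem_mk_right _ _⟩
    have huvne : u ≠ v := by
      have := hM.2.1 huv
      rw [SimpleGraph.mem_edgeSet] at this
      exact this.ne
    have h1 := matching_erase hM huv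
    have hu : ∀ e ∈ M.erase s(u, v), u ∉ e := fun e he h =>
      hM.2.2 _ huv e (Finset.mem_of_mem_erase he) (Finset.ne_of_mem_erase he).symm u
        (Sym2.mem_mk_left _ _) h
    have hv : ∀ e ∈ M.erase s(u, v), v ∉ e := fun e he h =>
      hM.2.2 _ huv e (Finset.mem_of_mem_erase he) (Finset.ne_of_mem_erase he).symm v
        (Sym2.mem_mk_right _ _) h
    have hx' : ∀ e ∈ M.erase s(u, v), x ∉ e := fun e he => notW x hx.2 e (Finset.mem_of_mem_erase he)
    have hy' : ∀ e ∈ M.erase s(u, v), y ∉ e := fun e he => notW y hy.2 e (Finset.mem_of_mem_erase he)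
    have h2 := matching_insert h1 hx.1 hu hx'
    have h3 := matching_insert h2 hy.1 (by
      intro e he
      rcases Finset.mem_insert.1 he with rfl | he
      · rw [Sym2.mem_iff, not_or]
        exact ⟨huvne.symm, fun h => hx.2 (h ▸ hvW)⟩
      · exact hv e he) (by
      intro e he
      rcases Finset.mem_insert.1 he with rfl | he
      · rw [Sym2.mem_iff, not_or]
        exact ⟨fun h => hy.2 (h ▸ huW), fun h => hxy h.symm⟩
      · exact hy' e he)
    rw [Nat.sub_add_cancel hK] at h3
    exact hno ⟨_, h3⟩
  have pair : ∀ u v, s(u, v) ∈ M → min 2 (N u).card + min 2 (N v).card ≤ 2 := by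
    intro u v huv
    rcases (N u).eq_empty_or_nonempty with h | ⟨x, hx⟩
    · rw [h, Finset.card_empty]; omega
    rcases (N v).eq_empty_or_nonempty with h | ⟨y, hy⟩
    · rw [h, Finset.card_empty]; omega
    have a := aug u v huv
    have h1 : (N u).card ≤ 1 := Finset.card_le_one.2 fun p hp q hq => (a p hp y hy).trans (a q hq y hy).symm
    have h2 : (N v).card ≤ 1 := Finset.card_le_one.2 fun p hp q hq => (a x hx p hp).symm.trans (a x hx q hq)
    omega
  have total : ∑ w ∈ W, min 2 (N w).card ≤ 2 * K := by
    calc _ ≤ ∑ e ∈ M, ∑ w ∈ e.toFinset, min 2 (N w).card := by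
            have hd : (M : Set (Sym2 V)).PairwiseDisjoint Sym2.toFinset := by
              intro e he e' he' hne
              rw [Function.onFun, Finset.disjoint_left]
              intro v hv hv'
              rw [Sym2.mem_toFinset] at hv hv'
              exact hM.2.2 e he e' he' hne v hv hv'
            rw [hW, Finset.sum_biUnion hd]
      _ ≤ ∑ e ∈ M, 2 := by
            refine Finset.sum_le_sum fun e he => ?_
            induction e with
            | _ a b =>
              have hab : a ≠ b := by
                have := hM.2.1 he
                rw [SimpleGraph.mem_edgeSet] at this
                exact this.ne
              rw [Sym2.toFinset_mk_eq, Finset.sum_pair hab]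
              exact pair a b he
      _ = 2 * K := by rw [Finset.sum_const, hM.1, smul_eq_mul, mul_comm]
  let S : Finset V := W.filter fun w => 2 ≤ (N w).card
  let R : Finset V := W.filter fun w => ¬ 2 ≤ (N w).card
  have split : ∑ w ∈ W, min 2 (N w).card = 2 * S.card + ∑ w ∈ R, (N w).card := by
    rw [← Finset.sum_filter_add_sum_filter_not W (fun w => 2 ≤ (N w).card)]
    congr 1
    · rw [Finset.sum_congr rfl (g := fun _ => 2), Finset.sum_const, smul_eq_mul, mul_comm]
      intro w hw
      exact min_eq_left (Finset.mem_filter.1 hw).2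
    · refine Finset.sum_congr rfl fun w hw => ?_
      have := (Finset.mem_filter.1 hw).2
      omega
  let Q : Finset (Sym2 V) := R.biUnion fun w => (N w).image fun x => s(w, x)
  have cardQ : Q.card ≤ ∑ w ∈ R, (N w).card :=
    Finset.card_biUnion_le.trans (Finset.sum_le_sum fun w _ => Finset.card_image_le)
  -- the graph inside `W`
  let H1 : SimpleGraph V :=
    { Adj := fun x y => G.Adj x y ∧ x ∈ W ∧ y ∈ W
      symm := ⟨fun x y h => ⟨h.1.symm, h.2.2, h.2.1⟩⟩
      loopless := ⟨fun x h => G.loopless.irrefl x h.1⟩ }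
  -- the bipartite graph between `S` and the unmatched vertices
  let H2 : SimpleGraph V :=
    { Adj := fun x y => G.Adj x y ∧ ((x ∈ S ∧ y ∉ W) ∨ (y ∈ S ∧ x ∉ W))
      symm := ⟨fun x y h => ⟨h.1.symm, h.2.symm⟩⟩
      loopless := ⟨fun x h => G.loopless.irrefl x h.1⟩ }
  have SW : ∀ x ∈ S, x ∈ W := fun x hx => (Finset.mem_filter.1 hx).1
  have cover : G.edgeSet ⊆ H1.edgeSet ∪ H2.edgeSet ∪ (Q : Set (Sym2 V)) := by
    have key : ∀ a b, G.Adj a b → a ∈ W → b ∉ W →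
        s(a, b) ∈ H1.edgeSet ∪ H2.edgeSet ∪ (Q : Set (Sym2 V)) := by
      intro a b hab ha hb
      by_cases hS : 2 ≤ (N a).card
      · left; right
        exact ⟨hab, Or.inl ⟨Finset.mem_filter.2 ⟨ha, hS⟩, hb⟩⟩
      · right
        rw [Finset.mem_coe, Finset.mem_biUnion]
        exact ⟨a, Finset.mem_filter.2 ⟨ha, hS⟩, Finset.mem_image.2 ⟨b, (memN a b).2 ⟨hab, hb⟩, rfl⟩⟩
    intro e
    induction e with
    | _ a b =>
      intro hab
      rw [SimpleGraph.mem_edgeSet] at hab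
      by_cases ha : a ∈ W <;> by_cases hb : b ∈ W
      · left; left; exact ⟨hab, ha, hb⟩
      · exact key a b hab ha hb
      · rw [Sym2.eq_swap]; exact key b a hab.symm hb ha
      · exact absurd hab (indep a b ha hb)
  have c0 : G.edgeSet.ncard ≤ H1.edgeSet.ncard + H2.edgeSet.ncard + Q.card := by
    refine (Set.ncard_le_ncard cover (Set.toFinite _)).trans ((Set.ncard_union_le _ _).trans ?_)
    rw [Set.ncard_coe_finset]
    exact Nat.add_le_add_right (Set.ncard_union_le _ _) _
  have Wne : W.Nonempty := by
    have : 0 < M.card := by rw [hM.1]; exact hK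
    obtain ⟨e, he⟩ := Finset.card_pos.1 this
    induction e with
    | _ a b => exact ⟨a, (memW a).2 ⟨_, he, Sym2.mem_mk_left _ _⟩⟩
  have c1 := planar_bound (hG.mono' (H := H1) fun a b h => h.1) W Wne fun v w h => h.2.1
  have cI : Wᶜ.card + W.card = Fintype.card V := by rw [add_comm]; exact Finset.card_add_card_compl W
  have Ine : Wᶜ.Nonempty := Finset.card_pos.1 (by omega)
  have c2 := planar_bip_bound (hG.mono' (H := H2) fun a b h => h.1) (S ∪ Wᶜ)
    (Ine.mono Finset.subset_union_right) (fun v w h => by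
      rw [Finset.mem_union, Finset.mem_compl]
      rcases h.2 with h | h
      · exact Or.inl h.1
      · exact Or.inr h.2) (fun v => v ∈ W) (fun v w h => by
      rcases h.2 with h | h
      · have := SW _ h.1; tauto
      · have := SW _ h.1; tauto)
  have c3 := Finset.card_union_le S Wᶜ
  omega


end PlanarityAndMatching

/-- Let `k ≥ 5`, `n ≥ 2k`, let `T` be a plane triangulation on `n` vertices and `G` a
spanning subgraph of `T` containing a matching of size `k − 1` and having at least
`2n + 6k − 16` edges. Then `G` contains a matching of size `k`. -/
theorem spanning_subgraph_contains_kMatching (n k : ℕ) (hk : 5 ≤ k) (hn : 2 * k ≤ n)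
    (T G : SimpleGraph (Fin n)) (hT : IsPlaneTriangulation T) (hGT : G ≤ T)
    (hsub : ∃ M : Finset (Sym2 (Fin n)), IsMatchingOfSize G M (k - 1))
    (hedges : 2 * n + 6 * k - 16 ≤ G.edgeSet.ncard) :
    ∃ M : Finset (Sym2 (Fin n)), IsMatchingOfSize G M k := by
  by_contra hno
  obtain ⟨M, hM⟩ := hsub
  have h := edges_le (hT.2.1.mono' hGT) (K := k - 1) (by omega)
    (by rw [Fintype.card_fin]; omega) hM (by rwa [Nat.sub_add_cancel (by omega)])
  rw [Fintype.card_fin] at h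
  omega
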